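/- Let u_n = p(n+1)p(n−1)/p(n)^2. Then for all integers n ≥ 2, one has 4(1 − u_n)(1 − u_{n+1}) < (1 + π/(√24 · n^{3/2}))·(1 − u_n u_{n+1})^2. -/

import Mathlib

/-- The partition function: the number of partitions of `n`. -/
noncomputable def partitionFun (n : ℕ) : ℕ := Fintype.card (Nat.Partition n)

/-- `u n = p(n+1) p(n-1) / p(n)^2`. -/
noncomputable def u (n : ℕ) : ℝ :=
  (partitionFun (n + 1) : ℝ) * (partitionFun (n - 1) : ℝ) / (partitionFun n : ℝ) ^ 2

open Filter Topology

/-! ### The generating function of partitions -/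

/-- The Taylor series at the origin of a function of one complex variable. -/
noncomputable def taylorPowerSeries (f : ℂ → ℂ) : PowerSeries ℂ :=
  PowerSeries.mk fun n ↦ iteratedDeriv n f 0 / n.factorial

lemma taylorPowerSeries_mul {f g : ℂ → ℂ} (hf : AnalyticAt ℂ f 0) (hg : AnalyticAt ℂ g 0) :
    taylorPowerSeries (f * g) = taylorPowerSeries f * taylorPowerSeries g := by
  ext n
  rw [PowerSeries.coeff_mul, Finset.Nat.sum_antidiagonal_eq_sum_range_succ_mk]
  simp only [taylorPowerSeries, PowerSeries.coeff_mk]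
  rw [iteratedDeriv_mul hf.contDiffAt hg.contDiffAt, Finset.sum_div]
  refine Finset.sum_congr rfl fun i hi ↦ ?_
  have hi' : i ≤ n := Nat.lt_succ_iff.mp (Finset.mem_range.mp hi)
  rw [Nat.cast_choose ℂ hi']
  have h1 : (n.factorial : ℂ) ≠ 0 := mod_cast n.factorial_ne_zero
  have h2 : (i.factorial : ℂ) ≠ 0 := mod_cast i.factorial_ne_zero
  have h3 : ((n - i).factorial : ℂ) ≠ 0 := mod_cast (n - i).factorial_ne_zero
  field_simp

lemma iteratedDeriv_polynomial_eval (P : Polynomial ℂ) (n : ℕ) :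
    iteratedDeriv n (fun x ↦ P.eval x) = fun x ↦ (Polynomial.derivative^[n] P).eval x := by
  induction n with
  | zero => simp
  | succ n ih =>
    rw [iteratedDeriv_succ, ih]
    ext x
    rw [Polynomial.deriv, Function.iterate_succ_apply']

lemma taylorPowerSeries_polynomial (P : Polynomial ℂ) :
    taylorPowerSeries (fun x ↦ P.eval x) = P := by
  ext n
  have h1 : (n.factorial : ℂ) ≠ 0 := mod_cast n.factorial_ne_zero
  simp [taylorPowerSeries, iteratedDeriv_polynomial_eval, ← Polynomial.coeff_zero_eq_eval_zero,
    Polynomial.coeff_iterate_derivative, Nat.descFactorial_self]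
  field_simp

/-- The Euler product `∏ (1 - q ^ n)` over all positive integers `n`. -/
noncomputable def eulerProd (q : ℂ) : ℂ := ∏' n : ℕ, (1 - q ^ (n + 1))

lemma eulerProd_ne_zero {q : ℂ} (hq : ‖q‖ < 1) : eulerProd q ≠ 0 := by
  have h := tprod_one_add_ne_zero_of_summable (f := fun n : ℕ ↦ -q ^ (n + 1)) ?_ ?_
  · simpa [eulerProd, sub_eq_add_neg] using h
  · intro n h
    have h1 : q ^ (n + 1) = 1 := by linear_combination -h
    have h2 : ‖q‖ ^ (n + 1) < 1 := pow_lt_one₀ (norm_nonneg _) hq (by simp)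
    rw [← norm_pow, h1, norm_one] at h2
    exact lt_irrefl _ h2
  · simpa using (summable_nat_add_iff 1).mpr (summable_geometric_of_lt_one (norm_nonneg _) hq)

lemma TendstoLocallyUniformlyOn.iteratedDeriv_complex {ι : Type*} {φ : Filter ι} {F : ι → ℂ → ℂ}
    {f : ℂ → ℂ} {U : Set ℂ} (hf : TendstoLocallyUniformlyOn F f φ U)
    (hF : ∀ i, DifferentiableOn ℂ (F i) U) (hU : IsOpen U) (n : ℕ) :
    TendstoLocallyUniformlyOn (fun i ↦ iteratedDeriv n (F i)) (iteratedDeriv n f) φ U ∧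
      ∀ i, DifferentiableOn ℂ (iteratedDeriv n (F i)) U := by
  induction n with
  | zero => simpa using ⟨hf, hF⟩
  | succ n ih =>
    simp only [iteratedDeriv_succ]
    exact ⟨ih.1.deriv (.of_forall ih.2) hU, fun i ↦ (ih.2 i).deriv hU⟩

lemma taylorPowerSeries_eulerProd :
    taylorPowerSeries eulerProd = PowerSeries.pentagonalSeries ℂ := by
  ext n
  have h := ModularForm.multipliableLocallyUniformlyOn_one_sub_pow.hasProdLocallyUniformlyOn
  have h1 := (TendstoLocallyUniformlyOn.iteratedDeriv_complex h
    (fun s ↦ DifferentiableOn.fun_finsetProd fun _ _ ↦ by fun_prop) Metric.isOpen_ball n).1.tendsto_at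
    (Metric.mem_ball_self one_pos)
  have h2 := h1.div_const (n.factorial : ℂ)
  rw [taylorPowerSeries, PowerSeries.coeff_mk]
  refine tendsto_nhds_unique h2 ?_
  refine tendsto_const_nhds.congr' ?_
  filter_upwards [PowerSeries.coeff_prod_one_sub_X_pow_eventually_eq ℂ n] with s hs
  have h3 := taylorPowerSeries_polynomial (∏ i ∈ s, (1 - Polynomial.X ^ (i + 1)))
  have h4 := congrArg (PowerSeries.coeff n) h3
  simp only [taylorPowerSeries, PowerSeries.coeff_mk, Polynomial.eval_prod, Polynomial.eval_sub,
    Polynomial.eval_one, Polynomial.eval_pow, Polynomial.eval_X] at h4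
  have h5 : ((∏ i ∈ s, (1 - Polynomial.X ^ (i + 1)) : Polynomial ℂ) : PowerSeries ℂ) =
      ∏ i ∈ s, (1 - PowerSeries.X ^ (i + 1)) := by
    rw [← Polynomial.coeToPowerSeries.ringHom_apply, map_prod]
    simp
  rw [h4, h5, hs]

/-- The generating function of partitions, as a power series. -/
noncomputable def partitionSeries (R : Type*) [CommRing R] : PowerSeries R :=
  PowerSeries.mk fun n ↦ (partitionFun n : R)

open PowerSeries.WithPiTopology in
lemma partitionSeries_mul_pentagonalSeries (R : Type*) [CommRing R] :
    partitionSeries R * PowerSeries.pentagonalSeries R = 1 := by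
  let _ : TopologicalSpace R := ⊥
  have _ : DiscreteTopology R := ⟨rfl⟩
  have h1 := Nat.Partition.hasProd_powerSeriesMk_card_restricted R (fun _ ↦ True)
  have h2 := h1.mul (hasProd_one_sub_X_pow R)
  have h3 : (PowerSeries.mk fun n ↦ ((Nat.Partition.restricted n fun _ ↦ True).card : R)) =
      partitionSeries R := by
    ext n
    simp [partitionSeries, partitionFun, Nat.Partition.restricted, Finset.card_univ]
  rw [h3] at h2
  refine h2.unique ?_
  convert! hasProd_one using 2 with i
  simp only [if_true, pow_mul]
  refine PowerSeries.WithPiTopology.tsum_pow_mul_one_sub_of_constantCoeff_eq_zero ?_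
  simp

lemma differentiableOn_eulerProd : DifferentiableOn ℂ eulerProd (Metric.ball 0 1) :=
  ModularForm.differentiableOn_tprod_one_sub_pow

/-- Euler's generating function for the partition numbers. -/
theorem hasSum_partitionFun_mul_pow {q : ℂ} (hq : ‖q‖ < 1) :
    HasSum (fun n ↦ (partitionFun n : ℂ) * q ^ n) (eulerProd q)⁻¹ := by
  have hE := differentiableOn_eulerProd
  have hI : DifferentiableOn ℂ (fun q ↦ (eulerProd q)⁻¹) (Metric.ball 0 1) :=
    hE.fun_inv fun x hx ↦ eulerProd_ne_zero (by simpa using hx)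
  have h0 : Metric.ball (0 : ℂ) 1 ∈ 𝓝 0 := Metric.ball_mem_nhds _ one_pos
  have hmul := taylorPowerSeries_mul (hE.analyticAt h0) (hI.analyticAt h0)
  have hone : taylorPowerSeries (eulerProd * fun q ↦ (eulerProd q)⁻¹) = 1 := by
    have h1 : (eulerProd * fun q ↦ (eulerProd q)⁻¹) =ᶠ[𝓝 0] fun x ↦ (1 : Polynomial ℂ).eval x := by
      filter_upwards [h0] with x hx
      simp [eulerProd_ne_zero (q := x) (by simpa using hx)]
    rw [← Polynomial.coe_one, ← taylorPowerSeries_polynomial]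
    ext n
    simp only [taylorPowerSeries, PowerSeries.coeff_mk, h1.iteratedDeriv_eq]
  rw [hone, taylorPowerSeries_eulerProd] at hmul
  have hT : taylorPowerSeries (fun q ↦ (eulerProd q)⁻¹) = partitionSeries ℂ := by
    rw [← one_mul (taylorPowerSeries _), ← partitionSeries_mul_pentagonalSeries ℂ, mul_assoc,
      ← hmul, mul_one]
  have h := Complex.hasSum_taylorSeries_on_ball hI (z := q) (by simpa using hq)
  convert! h using 2 with n
  have h5 := congrArg (PowerSeries.coeff n) hT
  simp only [taylorPowerSeries, partitionSeries, PowerSeries.coeff_mk] at h5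
  rw [← h5]
  simp only [sub_zero, smul_eq_mul]
  ring

/-! ### Modular transformation and norm bounds for the Euler product -/

lemma norm_cexp_neg_lt_one {z : ℂ} (hz : 0 < z.re) : ‖Complex.exp (-z)‖ < 1 := by
  rw [Complex.norm_exp]
  simpa using hz

/-- The transformation of the Euler product under `τ ↦ -1 / τ`. -/
lemma inv_eulerProd_cexp_neg {z : ℂ} (hz : 0 < z.re) :
    (eulerProd (Complex.exp (-z)))⁻¹ = (z / (2 * Real.pi)) ^ (1 / 2 : ℂ) *
      Complex.exp (Real.pi ^ 2 / 6 / z - z / 24) *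
        (eulerProd (Complex.exp (-(4 * Real.pi ^ 2 / z))))⁻¹ := by
  have hz0 : z ≠ 0 := by rintro rfl; simp at hz
  have hpi : (Real.pi : ℂ) ≠ 0 := mod_cast Real.pi_ne_zero
  have hI := Complex.I_ne_zero
  set τ : ℂ := Complex.I * (z / (2 * Real.pi)) with hτ
  have hzre : 0 < (z / (2 * Real.pi)).re := by
    rw [show z / (2 * Real.pi) = ((1 / (2 * Real.pi) : ℝ) : ℂ) * z by push_cast; ring,
      Complex.re_ofReal_mul]
    positivity
  have hτim : 0 < τ.im := by simpa [hτ, Complex.mul_im] using hzre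
  have h := ModularForm.eta_comp_eq_csqrt_I_inv hτim
  have hsqrt : Complex.sqrt τ = Complex.sqrt Complex.I * (z / (2 * Real.pi)) ^ (1 / 2 : ℂ) := by
    have hz1 : z / (2 * Real.pi) ≠ 0 := by simp [hz0]
    have harg := Complex.abs_arg_lt_pi_div_two_iff.mpr (Or.inl hzre)
    rw [abs_lt] at harg
    rw [Complex.sqrt, Complex.sqrt, hτ, one_div, Complex.cpow_def_of_ne_zero (mul_ne_zero hI hz1),
      Complex.cpow_def_of_ne_zero hI, Complex.cpow_def_of_ne_zero hz1, Complex.log_mul hI hz1,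
      add_mul, Complex.exp_add]
    rw [Complex.arg_I]
    constructor <;> linarith
  have hsI : Complex.sqrt Complex.I ≠ 0 := by simp [Complex.sqrt]
  have hinv : -1 / τ = 2 * Real.pi * Complex.I / z := by
    rw [hτ]; field_simp; simp
  have heta (w : ℂ) : ModularForm.eta w = Complex.exp (2 * Real.pi * Complex.I * w / 24) *
      eulerProd (Complex.exp (2 * Real.pi * Complex.I * w)) := by
    simp [ModularForm.eta, eulerProd, ModularForm.eta_q, Function.Periodic.qParam]
  have e1 : 2 * Real.pi * Complex.I * τ = -z := by
    rw [hτ]; field_simp; simp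
  have e2 : 2 * Real.pi * Complex.I * (2 * Real.pi * Complex.I / z) = -(4 * Real.pi ^ 2 / z) := by
    field_simp; rw [Complex.I_sq]; ring
  simp only [Function.comp_apply, Pi.smul_apply, Pi.mul_apply, smul_eq_mul] at h
  rw [hinv, hsqrt, heta, heta, e1, e2] at h
  have hw : 0 < (4 * Real.pi ^ 2 / z).re := by
    rw [show 4 * (Real.pi : ℂ) ^ 2 / z = ((4 * Real.pi ^ 2 : ℝ) : ℂ) * z⁻¹ by push_cast; ring,
      Complex.re_ofReal_mul, Complex.inv_re]
    have := Complex.normSq_pos.mpr hz0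
    positivity
  have n1 := eulerProd_ne_zero (norm_cexp_neg_lt_one hz)
  have n2 := eulerProd_ne_zero (norm_cexp_neg_lt_one hw)
  have h' : Complex.exp (-(4 * Real.pi ^ 2 / z) / 24) * eulerProd (Complex.exp (-(4 * Real.pi ^ 2 / z)))
      = (z / (2 * Real.pi)) ^ (1 / 2 : ℂ) * Complex.exp (-z / 24) * eulerProd (Complex.exp (-z)) := by
    rw [h]; field_simp
  rw [inv_eq_iff_eq_inv, mul_inv, mul_inv, inv_inv, eq_comm]
  have e3 : Complex.exp (Real.pi ^ 2 / 6 / z - z / 24) =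
      Complex.exp (-z / 24) / Complex.exp (-(4 * Real.pi ^ 2 / z) / 24) := by
    rw [← Complex.exp_sub]; congr 1; field_simp; ring
  have n3 : (z / (2 * Real.pi)) ^ (1 / 2 : ℂ) ≠ 0 := by
    rw [Complex.cpow_ne_zero_iff]; left; simp [hz0]
  rw [e3]
  have n4 := Complex.exp_ne_zero (-z / 24)
  have n5 := Complex.exp_ne_zero (-(4 * Real.pi ^ 2 / z) / 24)
  clear e3
  generalize Complex.exp (-z / 24) = x at *
  generalize Complex.exp (-(4 * Real.pi ^ 2 / z) / 24) = y at *
  generalize eulerProd (Complex.exp (-(4 * Real.pi ^ 2 / z))) = e at *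
  generalize (z / (2 * Real.pi)) ^ (1 / 2 : ℂ) = c at *
  field_simp
  linear_combination h'

lemma hasSum_inv_eulerProd_real {r : ℝ} (h0 : 0 ≤ r) (h1 : r < 1) :
    HasSum (fun n ↦ (partitionFun n : ℝ) * r ^ n) ((eulerProd r)⁻¹).re := by
  have h := hasSum_partitionFun_mul_pow (q := (r : ℂ)) (by simpa [abs_of_nonneg h0] using h1)
  have := Complex.hasSum_re h
  convert! this using 2 with n
  norm_cast

lemma tendsto_prod_eulerProd {q : ℂ} (hq : ‖q‖ < 1) :
    Tendsto (fun s : Finset ℕ ↦ ∏ n ∈ s, (1 - q ^ (n + 1))) atTop (𝓝 (eulerProd q)) := by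
  have h : Multipliable fun n : ℕ ↦ (1 + -q ^ (n + 1)) := by
    refine multipliable_one_add_of_summable ?_
    simpa using (summable_nat_add_iff 1).mpr (summable_geometric_of_lt_one (norm_nonneg _) hq)
  simp only [← sub_eq_add_neg] at h
  exact h.hasProd

lemma norm_inv_eulerProd_sub_one_le {q : ℂ} (hq : ‖q‖ ≤ 1 / 10) :
    ‖(eulerProd q)⁻¹ - 1‖ ≤ 2 * ‖q‖ := by
  have hq1 : ‖q‖ < 1 := by linarith
  have h0 := norm_nonneg q
  set r := ‖q‖ with hr
  have hsum : HasSum (fun n : ℕ ↦ r ^ (n + 1)) (r / (1 - r)) := by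
    have := (hasSum_geometric_of_lt_one h0 hq1).mul_left r
    simpa [pow_succ', div_eq_mul_inv] using this
  have h1 : ‖eulerProd q - 1‖ ≤ Real.exp (r / (1 - r)) - 1 := by
    refine le_of_tendsto ((tendsto_prod_eulerProd hq1).sub_const 1).norm (.of_forall fun s ↦ ?_)
    have := s.norm_prod_one_add_sub_one_le fun n ↦ -q ^ (n + 1)
    simp only [← sub_eq_add_neg, norm_neg, norm_pow] at this
    refine this.trans ?_
    gcongr
    exact hsum.summable.sum_le_tsum _ (fun i _ ↦ by positivity) |>.trans hsum.tsum_eq.le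
  have hx : r / (1 - r) ≤ 10 / 9 * r := by
    rw [div_le_iff₀ (by linarith)]; nlinarith
  have hx0 : 0 ≤ r / (1 - r) := div_nonneg h0 (by linarith)
  have h2 : Real.exp (r / (1 - r)) - 1 ≤ 5 / 4 * r := by
    have := Real.exp_bound_div_one_sub_of_interval hx0 (x := r / (1 - r)) (by linarith)
    have h3 : 1 / (1 - r / (1 - r)) ≤ 1 + 5 / 4 * r := by
      rw [div_le_iff₀ (by linarith)]
      nlinarith
    linarith
  have h3 : ‖eulerProd q - 1‖ ≤ 5 / 4 * r := h1.trans h2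
  have h4 : 7 / 8 ≤ ‖eulerProd q‖ := by
    have := norm_sub_norm_le (1 : ℂ) (1 - eulerProd q)
    rw [norm_one, norm_sub_rev 1 (eulerProd q), sub_sub_cancel] at this
    linarith
  have h5 : (eulerProd q)⁻¹ - 1 = -(eulerProd q - 1) / eulerProd q := by
    have := eulerProd_ne_zero hq1
    field_simp
    ring
  rw [h5, norm_div, norm_neg, div_le_iff₀ (by linarith)]
  nlinarith

lemma Real.exp_two_mul_le_div {x : ℝ} (h0 : 0 ≤ x) (h1 : x < 1) :
    Real.exp (2 * x) ≤ (1 + x) / (1 - x) := by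
  have h2 : 0 < 1 - x := by linarith
  have h := Real.le_log_one_add_of_nonneg (x := 2 * x / (1 - x)) (by positivity)
  have e1 : 2 * (2 * x / (1 - x)) / (2 * x / (1 - x) + 2) = 2 * x := by
    field_simp; ring
  have e2 : 1 + 2 * x / (1 - x) = (1 + x) / (1 - x) := by
    field_simp; ring
  rw [e1, e2] at h
  calc Real.exp (2 * x) ≤ Real.exp (Real.log ((1 + x) / (1 - x))) := Real.exp_le_exp.mpr h
    _ = _ := Real.exp_log (by positivity)

lemma one_sub_norm_mul_exp_le_norm_one_sub {w : ℂ} (hw : ‖w‖ < 1) :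
    (1 - ‖w‖) * Real.exp (‖w‖ - w.re) ≤ ‖1 - w‖ := by
  have hρ := norm_nonneg w
  have hre := abs_le.mp (Complex.abs_re_le_norm w)
  have hsq : ‖1 - w‖ ^ 2 = (1 - ‖w‖) ^ 2 + 2 * (‖w‖ - w.re) := by
    have h1 := Complex.sq_norm w
    rw [Complex.normSq_apply] at h1
    rw [Complex.sq_norm, Complex.normSq_apply]
    simp only [Complex.sub_re, Complex.sub_im, Complex.one_re, Complex.one_im]
    linarith
  refine le_of_abs_le (abs_le_of_sq_le_sq ?_ (norm_nonneg _))
  rw [hsq]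
  set ρ := ‖w‖
  set s := ρ - w.re with hs
  have hs0 : 0 ≤ s := by linarith
  have hs1 : s ≤ 2 * ρ := by linarith
  rw [mul_pow, ← Real.exp_nat_mul]
  push_cast
  rcases hρ.eq_or_lt with h0 | h0
  · have : s = 0 := by linarith
    simp [this]
  have hconv : Real.exp (2 * s) ≤ 1 + s / (2 * ρ) * (Real.exp (4 * ρ) - 1) := by
    have hc := convexOn_exp.2 (Set.mem_univ 0) (Set.mem_univ (4 * ρ))
      (sub_nonneg.mpr ((div_le_one₀ (by positivity : 0 < 2 * ρ)).mpr hs1))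
      (by positivity : 0 ≤ s / (2 * ρ)) (by ring)
    simp only [smul_eq_mul, mul_zero, Real.exp_zero, zero_add, mul_one] at hc
    rw [show s / (2 * ρ) * (4 * ρ) = 2 * s by field_simp; norm_num] at hc
    linarith
  have he : Real.exp (4 * ρ) * (1 - ρ) ^ 2 ≤ (1 + ρ) ^ 2 := by
    have h := Real.exp_two_mul_le_div h0.le hw
    rw [le_div_iff₀ (by linarith)] at h
    rw [show 4 * ρ = 2 * ρ + 2 * ρ by ring, Real.exp_add]
    have : 0 < 1 - ρ := by linarith
    calc _ = (Real.exp (2 * ρ) * (1 - ρ)) ^ 2 := by ring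
      _ ≤ _ := by gcongr
  have hs2 : 0 ≤ s / (2 * ρ) := by positivity
  calc (1 - ρ) ^ 2 * Real.exp (2 * s) ≤ (1 - ρ) ^ 2 * (1 + s / (2 * ρ) * (Real.exp (4 * ρ) - 1)) := by gcongr
    _ = (1 - ρ) ^ 2 + s / (2 * ρ) * (Real.exp (4 * ρ) * (1 - ρ) ^ 2 - (1 - ρ) ^ 2) := by ring
    _ ≤ (1 - ρ) ^ 2 + s / (2 * ρ) * ((1 + ρ) ^ 2 - (1 - ρ) ^ 2) := by gcongr
    _ = _ := by field_simp; ring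

/-- Off the positive real axis the Euler product is exponentially larger. -/
lemma norm_inv_eulerProd_le_mul_exp {q : ℂ} (hq : ‖q‖ < 1) :
    ‖(eulerProd q)⁻¹‖ ≤ ‖(eulerProd (‖q‖ : ℝ))⁻¹‖ *
      Real.exp (-((1 - ‖q‖)⁻¹ - ((1 - q)⁻¹).re)) := by
  set r := ‖q‖ with hr
  have h0 : 0 ≤ r := norm_nonneg q
  have hr1 : ‖((r : ℝ) : ℂ)‖ < 1 := by simpa [abs_of_nonneg h0] using hq
  have hs1 : HasSum (fun n : ℕ ↦ r ^ (n + 1)) ((1 - r)⁻¹ - 1) := by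
    have := hasSum_geometric_of_lt_one h0 hq
    rw [← hasSum_nat_add_iff' 1] at this
    simpa using this
  have hs2 : HasSum (fun n : ℕ ↦ (q ^ (n + 1)).re) (((1 - q)⁻¹).re - 1) := by
    have := hasSum_geometric_of_norm_lt_one hq
    rw [← hasSum_nat_add_iff' 1] at this
    have := Complex.hasSum_re this
    simpa using this
  have key : ‖eulerProd r‖ * Real.exp ((1 - r)⁻¹ - ((1 - q)⁻¹).re) ≤ ‖eulerProd q‖ := by
    have t1 := ((tendsto_prod_eulerProd hr1).norm).mul
      ((Real.continuous_exp.tendsto _).comp (hs1.sub hs2))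
    rw [show (1 - r)⁻¹ - 1 - (((1 - q)⁻¹).re - 1) = (1 - r)⁻¹ - ((1 - q)⁻¹).re by ring] at t1
    refine le_of_tendsto_of_tendsto' t1 (tendsto_prod_eulerProd hq).norm fun s ↦ ?_
    simp only [Function.comp, norm_prod, Real.exp_sum, ← Finset.prod_mul_distrib]
    refine Finset.prod_le_prod (fun i _ ↦ by positivity) fun i _ ↦ ?_
    have h1 : r ^ (i + 1) < 1 := pow_lt_one₀ h0 hq (by simp)
    have h2 := one_sub_norm_mul_exp_le_norm_one_sub (w := q ^ (i + 1)) (by rwa [norm_pow])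
    rw [norm_pow, ← hr] at h2
    have h3 : ‖1 - (r : ℂ) ^ (i + 1)‖ = 1 - r ^ (i + 1) := by
      rw [← Complex.ofReal_pow, ← Complex.ofReal_one, ← Complex.ofReal_sub, Complex.norm_real,
        Real.norm_of_nonneg (by linarith)]
    rwa [h3]
  have p1 := norm_pos_iff.mpr (eulerProd_ne_zero hq)
  have p2 := norm_pos_iff.mpr (eulerProd_ne_zero hr1)
  rw [norm_inv, norm_inv, Real.exp_neg, ← mul_inv]
  exact inv_anti₀ (by positivity) key

/-! ### The circle method -/

lemma continuous_inv_eulerProd_cexp {t : ℝ} (ht : 0 < t) :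
    Continuous fun θ : ℝ ↦ (eulerProd (Complex.exp (-(t + θ * Complex.I))))⁻¹ := by
  have h (θ : ℝ) : ‖Complex.exp (-(t + θ * Complex.I))‖ < 1 :=
    norm_cexp_neg_lt_one (by simpa using ht)
  refine Continuous.inv₀ ?_ fun θ ↦ eulerProd_ne_zero (h θ)
  exact differentiableOn_eulerProd.continuousOn.comp_continuous (by fun_prop)
    fun θ ↦ by simpa using h θ

/-- Cauchy's integral for the partition numbers. -/
lemma partitionFun_eq_integral (n : ℕ) {t : ℝ} (ht : 0 < t) :
    (2 * Real.pi * partitionFun n : ℂ) = ∫ θ in (-Real.pi)..Real.pi,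
      (eulerProd (Complex.exp (-(t + θ * Complex.I))))⁻¹ *
        Complex.exp (n * (t + θ * Complex.I)) := by
  set q : ℝ → ℂ := fun θ ↦ Complex.exp (-(t + θ * Complex.I)) with hq
  have hqn (θ : ℝ) : ‖q θ‖ = Real.exp (-t) := by simp [hq, Complex.norm_exp]
  have hexp : Real.exp (-t) < 1 := by simpa using ht
  let f (m : ℕ) : C(ℝ, ℂ) :=
    ⟨fun θ ↦ partitionFun m * q θ ^ m * Complex.exp (n * (t + θ * Complex.I)), by fun_prop⟩
  have hsum : Summable fun m ↦ (partitionFun m : ℝ) * Real.exp (-t) ^ m := by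
    have h := (hasSum_partitionFun_mul_pow (q := (Real.exp (-t) : ℝ)) (by
      rw [Complex.norm_real, Real.norm_of_nonneg (Real.exp_pos _).le]; exact hexp)).summable
    exact_mod_cast h
  have h := intervalIntegral.hasSum_intervalIntegral_of_summable_norm (a := -Real.pi)
    (b := Real.pi) (f := f) (by
      refine Summable.of_nonneg_of_le (fun _ ↦ norm_nonneg _) (fun m ↦ ?_)
        (hsum.mul_right (Real.exp (n * t)))
      refine (ContinuousMap.norm_le _ (by positivity)).mpr fun x ↦ ?_
      simp [f, hqn, Complex.norm_exp])
  have h1 (θ : ℝ) : ∑' m, f m θ = (eulerProd (q θ))⁻¹ * Complex.exp (n * (t + θ * Complex.I)) :=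
    ((hasSum_partitionFun_mul_pow (q := q θ) (by rw [hqn]; exact hexp)).mul_right _).tsum_eq
  simp only [h1] at h
  have hfm (m : ℕ) (θ : ℝ) : f m θ = partitionFun m * Complex.exp ((n - m) * t) *
      Complex.exp ((n - m) * Complex.I * θ) := by
    simp only [f, hq, ContinuousMap.coe_mk]
    rw [← Complex.exp_nat_mul, mul_assoc, mul_assoc, ← Complex.exp_add, ← Complex.exp_add]
    ring_nf
  have h0 (m : ℕ) (hm : m ≠ n) : ∫ θ in (-Real.pi)..Real.pi, f m θ = 0 := by
    have hc : ((n : ℂ) - m) * Complex.I ≠ 0 :=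
      mul_ne_zero (sub_ne_zero.mpr (by exact_mod_cast hm.symm)) Complex.I_ne_zero
    simp only [hfm, intervalIntegral.integral_const_mul, integral_exp_mul_complex hc]
    have : Complex.exp ((n - m) * Complex.I * Real.pi) =
        Complex.exp ((n - m) * Complex.I * (-Real.pi : ℝ)) := by
      rw [Complex.exp_eq_exp_iff_exists_int]
      exact ⟨n - m, by push_cast; ring⟩
    rw [this]
    simp
  refine Eq.trans ?_ (h.unique (hasSum_single n h0)).symm
  simp only [hfm, sub_self, zero_mul, Complex.exp_zero, mul_one, intervalIntegral.integral_const,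
    Complex.real_smul]
  push_cast
  ring

lemma inv_sub_re_inv_ge {t θ : ℝ} (ht : 0 < t) (ht1 : t ≤ 1 / 25) (h2 : 2 * t ≤ |θ|)
    (h3 : |θ| ≤ Real.pi) :
    3 / 4 / t ≤ (1 - Real.exp (-t))⁻¹ -
      ((1 - Complex.exp (-(t + θ * Complex.I)))⁻¹).re := by
  set r := Real.exp (-t) with hr
  have hr1 : r < 1 := by simpa [hr] using ht
  have hr0 : 1 - t ≤ r := by have := Real.add_one_le_exp (-t); linarith
  have hq : Complex.exp (-(t + θ * Complex.I)) = r * (Real.cos θ - Real.sin θ * Complex.I) := by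
    rw [neg_add, Complex.exp_add, hr, Complex.ofReal_exp, Complex.ofReal_neg, ← neg_mul,
      Complex.exp_mul_I, Complex.cos_neg, Complex.sin_neg]
    push_cast; ring
  have hre : (1 - Complex.exp (-(t + θ * Complex.I))).re = 1 - r * Real.cos θ := by
    rw [hq]; simp [-Complex.ofReal_cos, -Complex.ofReal_sin]
  have hns : Complex.normSq (1 - Complex.exp (-(t + θ * Complex.I))) =
      (1 - r) ^ 2 + 2 * r * (1 - Real.cos θ) := by
    rw [hq, Complex.normSq_apply]
    simp [-Complex.ofReal_cos, -Complex.ofReal_sin]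
    linear_combination r ^ 2 * Real.sin_sq_add_cos_sq θ
  rw [Complex.inv_re, hre, hns]
  have hcos : Real.cos θ ≤ Real.cos (2 * t) := by
    rw [← Real.cos_abs θ]
    exact Real.cos_le_cos_of_nonneg_of_le_pi (by positivity) h3 h2
  have hx : 1.99 * t ^ 2 ≤ 1 - Real.cos θ := by
    have h4 := Real.sin_gt_sub_cube ht
    rw [Real.cos_two_mul, Real.cos_sq'] at hcos
    have h5 : 0.999 * t ≤ Real.sin t := by nlinarith [mul_pos ht ht]
    nlinarith [mul_pos ht ht]
  set x := 1 - Real.cos θ with hxd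
  have hx0 : 0 < x := lt_of_lt_of_le (by positivity) hx
  have hd : 0 < 1 - r := by linarith
  have hr' : 0 < r := Real.exp_pos _
  have e : (1 - r)⁻¹ - (1 - r * Real.cos θ) / ((1 - r) ^ 2 + 2 * r * x) =
      r * (1 + r) * x / ((1 - r) * ((1 - r) ^ 2 + 2 * r * x)) := by
    rw [show Real.cos θ = 1 - x by rw [hxd]; ring]
    field_simp
    ring
  rw [e, div_div, div_le_div_iff₀ (by positivity) (by positivity)]
  have key : 3 / 4 * ((1 - r) ^ 2 + 2 * r * x) ≤ r * (1 + r) * x := by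
    have h6 : (1 - r) ^ 2 ≤ t ^ 2 := by nlinarith
    have h7 : 0.44 ≤ r * (r - 1 / 2) := by nlinarith
    nlinarith
  calc 3 * ((1 - r) * ((1 - r) ^ 2 + 2 * r * x)) = 4 * (1 - r) * (3 / 4 * ((1 - r) ^ 2 + 2 * r * x)) := by ring
    _ ≤ 4 * t * (r * (1 + r) * x) := by gcongr; linarith
    _ = _ := by ring

lemma norm_inv_eulerProd_le_of_minor {t θ : ℝ} (ht : 0 < t) (ht1 : t ≤ 1 / 25)
    (h2 : 2 * t ≤ |θ|) (h3 : |θ| ≤ Real.pi) :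
    ‖(eulerProd (Complex.exp (-(t + θ * Complex.I))))⁻¹‖ ≤
      √t * Real.exp (Real.pi ^ 2 / 6 / t - t / 24 - 3 / 4 / t) := by
  have hn : ‖Complex.exp (-(t + θ * Complex.I))‖ = Real.exp (-t) := by simp [Complex.norm_exp]
  have h := norm_inv_eulerProd_le_mul_exp (q := Complex.exp (-(t + θ * Complex.I)))
    (norm_cexp_neg_lt_one (by simpa using ht))
  rw [hn] at h
  have hG := inv_sub_re_inv_ge ht ht1 h2 h3
  have hP : ‖(eulerProd (Real.exp (-t) : ℝ))⁻¹‖ ≤ √t * Real.exp (Real.pi ^ 2 / 6 / t - t / 24) := by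
    have h1 := inv_eulerProd_cexp_neg (z := t) (by simpa using ht)
    rw [Complex.ofReal_exp, Complex.ofReal_neg, h1, norm_mul, norm_mul]
    have hr : ‖Complex.exp (-(4 * Real.pi ^ 2 / t))‖ ≤ 1 / 10 := by
      have e1 : -(4 * (Real.pi : ℂ) ^ 2 / t) = ((-(4 * Real.pi ^ 2 / t) : ℝ) : ℂ) := by push_cast; rfl
      rw [Complex.norm_exp, e1, Complex.ofReal_re, Real.exp_neg, one_div]
      refine inv_anti₀ (by norm_num) ?_
      have h8 : 9 ≤ 4 * Real.pi ^ 2 / t := by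
        rw [le_div_iff₀ ht]; nlinarith [Real.pi_gt_three]
      linarith [Real.add_one_le_exp (4 * Real.pi ^ 2 / t)]
    have h4 := norm_inv_eulerProd_sub_one_le hr
    have h5 : ‖(eulerProd (Complex.exp (-(4 * Real.pi ^ 2 / t))))⁻¹‖ ≤ 2 := by
      have := norm_sub_norm_le (eulerProd (Complex.exp (-(4 * Real.pi ^ 2 / t))))⁻¹ 1
      rw [norm_one] at this
      linarith
    have h6 : ‖((t : ℂ) / (2 * Real.pi)) ^ (1 / 2 : ℂ)‖ ≤ √t * (1 / 2) := by
      have e1 : (t : ℂ) / (2 * Real.pi) = ((t / (2 * Real.pi) : ℝ) : ℂ) := by push_cast; rfl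
      have e2 : (1 / 2 : ℂ) = ((1 / 2 : ℝ) : ℂ) := by push_cast; rfl
      rw [e1, e2, ← Complex.ofReal_cpow (by positivity), Complex.norm_real,
        Real.norm_of_nonneg (by positivity), ← Real.sqrt_eq_rpow, div_eq_mul_inv,
        Real.sqrt_mul ht.le]
      gcongr
      rw [Real.sqrt_le_left (by norm_num), inv_eq_one_div, div_le_iff₀ (by positivity)]
      nlinarith [Real.pi_gt_three]
    have h7 : ‖Complex.exp (Real.pi ^ 2 / 6 / t - t / 24)‖ = Real.exp (Real.pi ^ 2 / 6 / t - t / 24) := by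
      rw [Complex.norm_exp]; norm_cast
    rw [h7]
    calc _ ≤ √t * (1 / 2) * Real.exp (Real.pi ^ 2 / 6 / t - t / 24) * 2 := by gcongr
      _ = _ := by ring
  calc _ ≤ _ := h
    _ ≤ √t * Real.exp (Real.pi ^ 2 / 6 / t - t / 24) * Real.exp (-(3 / 4 / t)) := by gcongr
    _ = _ := by rw [mul_assoc, ← Real.exp_add, ← sub_eq_add_neg]

/-! ### The integral over the saddle point -/

lemma abs_integral_gaussian_sub_le {b : ℝ} (hb : 0 < b) :
    |(∫ y in (-(1 / 2 : ℝ))..(1 / 2), Real.exp (-b * y ^ 2)) - √(Real.pi / b)| ≤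
      4 / b * Real.exp (-b / 4) := by
  have hi := (integrable_exp_neg_mul_sq hb)
  have h0 := integral_gaussian_Ioi b
  have h1 := intervalIntegral.integral_interval_add_Ioi (a := 0) (b := 1 / 2)
    hi.integrableOn hi.integrableOn
  have h2 : ∫ y in (-(1 / 2 : ℝ))..0, Real.exp (-b * y ^ 2) =
      ∫ y in (0 : ℝ)..(1 / 2), Real.exp (-b * y ^ 2) := by
    have := intervalIntegral.integral_comp_neg (a := 0) (b := 1 / 2)
      (fun y ↦ Real.exp (-b * y ^ 2))
    simp only [neg_sq, neg_zero] at this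
    exact this.symm
  have h3 := intervalIntegral.integral_add_adjacent_intervals (a := -(1 / 2 : ℝ)) (b := 0)
    (c := 1 / 2) (f := fun y ↦ Real.exp (-b * y ^ 2)) (μ := MeasureTheory.volume)
    hi.intervalIntegrable hi.intervalIntegrable
  have h4 : 0 ≤ ∫ y in Set.Ioi (1 / 2 : ℝ), Real.exp (-b * y ^ 2) :=
    MeasureTheory.setIntegral_nonneg measurableSet_Ioi fun _ _ ↦ (Real.exp_pos _).le
  have h5 : ∫ y in Set.Ioi (1 / 2 : ℝ), Real.exp (-b * y ^ 2) ≤ 2 / b * Real.exp (-b / 4) := by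
    have h6 := integral_exp_mul_Ioi (a := -b / 2) (by linarith) (1 / 2)
    have h7 : ∫ y in Set.Ioi (1 / 2 : ℝ), Real.exp (-b * y ^ 2) ≤
        ∫ y in Set.Ioi (1 / 2 : ℝ), Real.exp (-b / 2 * y) := by
      refine MeasureTheory.setIntegral_mono_on hi.integrableOn ?_ measurableSet_Ioi fun y hy ↦ ?_
      · exact integrableOn_exp_mul_Ioi (by linarith) _
      · have hy' : 1 / 2 < y := hy
        refine Real.exp_le_exp.mpr ?_
        have : 0 ≤ b * (y * (y - 1 / 2)) := by
          have : 0 < y - 1 / 2 := by linarith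
          positivity
        linarith
    refine h7.trans (h6.trans_le (le_of_eq ?_))
    rw [show -b / 2 * (1 / 2) = -b / 4 by ring]
    field_simp
  rw [abs_le]
  constructor
  · have : 4 / b * Real.exp (-b / 4) = 2 * (2 / b * Real.exp (-b / 4)) := by ring
    linarith
  · have : 0 ≤ 4 / b * Real.exp (-b / 4) := by positivity
    linarith

lemma integral_cos_mul_exp_cos (M : ℝ) :
    ∫ ψ in (-(Real.pi / 3))..(Real.pi / 3),
      Real.cos (3 * ψ / 2) * Real.exp (2 * M * Real.cos ψ) =
    ∫ y in (-(1 / 2 : ℝ))..(1 / 2), (2 - 8 * y ^ 2) * Real.exp (2 * M - 4 * M * y ^ 2) := by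
  have h := intervalIntegral.integral_comp_mul_deriv (a := -(Real.pi / 3)) (b := Real.pi / 3)
    (f := fun ψ ↦ Real.sin (ψ / 2)) (f' := fun ψ ↦ Real.cos (ψ / 2) * (1 / 2))
    (g := fun y ↦ (2 - 8 * y ^ 2) * Real.exp (2 * M - 4 * M * y ^ 2))
    (fun x _ ↦ ((hasDerivAt_id x).div_const 2).sin) (by fun_prop) (by fun_prop)
  have e1 : Real.sin (Real.pi / 3 / 2) = 1 / 2 := by
    rw [div_div]; norm_num
  have e2 : Real.sin (-(Real.pi / 3) / 2) = -(1 / 2) := by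
    rw [neg_div, Real.sin_neg, e1]
  rw [e1, e2] at h
  rw [← h]
  refine intervalIntegral.integral_congr fun ψ _ ↦ ?_
  have e3 : Real.cos (3 * ψ / 2) = 4 * Real.cos (ψ / 2) ^ 3 - 3 * Real.cos (ψ / 2) := by
    rw [← Real.cos_three_mul]; ring_nf
  have e4 : Real.cos ψ = 1 - 2 * Real.sin (ψ / 2) ^ 2 := by
    have h6 := Real.cos_two_mul (ψ / 2)
    rw [Real.cos_sq', show 2 * (ψ / 2) = ψ by ring] at h6
    linarith
  have e5 := Real.sin_sq_add_cos_sq (ψ / 2)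
  simp only [Function.comp]
  rw [e3, e4, show 2 * M * (1 - 2 * Real.sin (ψ / 2) ^ 2) = 2 * M - 4 * M * Real.sin (ψ / 2) ^ 2 by ring]
  linear_combination 4 * Real.cos (ψ / 2) * Real.exp (2 * M - 4 * M * Real.sin (ψ / 2) ^ 2) * e5

lemma integral_sub_mul_exp {M : ℝ} (hM : 0 < M) :
    ∫ y in (-(1 / 2 : ℝ))..(1 / 2), (2 - 8 * y ^ 2) * Real.exp (2 * M - 4 * M * y ^ 2) =
      Real.exp (2 * M) * ((2 - 1 / M) * (∫ y in (-(1 / 2 : ℝ))..(1 / 2), Real.exp (-(4 * M) * y ^ 2)) +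
        Real.exp (-M) / M) := by
  have hd (y : ℝ) : HasDerivAt (fun y ↦ y * Real.exp (-(4 * M) * y ^ 2))
      (Real.exp (-(4 * M) * y ^ 2) - 8 * M * y ^ 2 * Real.exp (-(4 * M) * y ^ 2)) y := by
    have := (hasDerivAt_id y).mul (((hasDerivAt_pow 2 y).const_mul (-(4 * M))).exp)
    refine this.congr_deriv ?_
    simp only [id]
    push_cast
    ring
  have h := intervalIntegral.integral_eq_sub_of_hasDerivAt (a := -(1 / 2 : ℝ)) (b := 1 / 2)
    (fun y _ ↦ hd y) (Continuous.intervalIntegrable (by fun_prop) _ _)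
  have h1 : (fun y : ℝ ↦ (2 - 8 * y ^ 2) * Real.exp (2 * M - 4 * M * y ^ 2)) = fun y ↦
      Real.exp (2 * M) * ((2 - 1 / M) * Real.exp (-(4 * M) * y ^ 2) + 1 / M *
        (Real.exp (-(4 * M) * y ^ 2) - 8 * M * y ^ 2 * Real.exp (-(4 * M) * y ^ 2))) := by
    ext y
    rw [show 2 * M - 4 * M * y ^ 2 = 2 * M + -(4 * M) * y ^ 2 by ring, Real.exp_add]
    field_simp
    ring
  rw [h1, intervalIntegral.integral_const_mul, intervalIntegral.integral_add,
    intervalIntegral.integral_const_mul, intervalIntegral.integral_const_mul, h]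
  · congr 2
    rw [show -(4 * M) * (1 / 2) ^ 2 = -M by ring, show -(4 * M) * (-(1 / 2)) ^ 2 = -M by ring]
    ring
  all_goals exact Continuous.intervalIntegrable (by fun_prop) _ _

lemma abs_integral_cos_mul_exp_cos_sub_le {M : ℝ} (hM : 1 ≤ M) :
    |(∫ ψ in (-(Real.pi / 3))..(Real.pi / 3),
      Real.cos (3 * ψ / 2) * Real.exp (2 * M * Real.cos ψ)) -
      Real.exp (2 * M) * (√(Real.pi / M) * (1 - 1 / (2 * M)))| ≤ 3 * Real.exp M := by
  have hM0 : 0 < M := by linarith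
  rw [integral_cos_mul_exp_cos, integral_sub_mul_exp hM0, ← mul_sub, abs_mul, abs_of_pos (Real.exp_pos _)]
  have h := abs_integral_gaussian_sub_le (b := 4 * M) (by linarith)
  set G := ∫ y in (-(1 / 2 : ℝ))..(1 / 2), Real.exp (-(4 * M) * y ^ 2)
  have e1 : √(Real.pi / M) = 2 * √(Real.pi / (4 * M)) := by
    rw [show Real.pi / M = 2 ^ 2 * (Real.pi / (4 * M)) by field_simp; norm_num, Real.sqrt_mul (by norm_num),
      Real.sqrt_sq (by norm_num)]
  have e2 : (2 - 1 / M) * G + Real.exp (-M) / M - √(Real.pi / M) * (1 - 1 / (2 * M)) =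
      (2 - 1 / M) * (G - √(Real.pi / (4 * M))) + Real.exp (-M) / M := by
    rw [e1]; field_simp; ring
  rw [e2, show 4 / (4 * M) * Real.exp (-(4 * M) / 4) = Real.exp (-M) / M by field_simp] at *
  have h3 : Real.exp (-M) / M ≤ Real.exp (-M) := div_le_self (Real.exp_pos _).le hM
  have h4 : 0 ≤ 1 / M := by positivity
  have h5 : 1 / M ≤ 1 := by rw [div_le_one₀ hM0]; exact hM
  have h6 : |(2 - 1 / M) * (G - √(Real.pi / (4 * M))) + Real.exp (-M) / M| ≤ 3 * Real.exp (-M) := by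
    refine (abs_add_le _ _).trans ?_
    rw [abs_mul, abs_of_nonneg (by linarith : 0 ≤ 2 - 1 / M), abs_of_pos (a := Real.exp (-M) / M) (by positivity)]
    have : (2 - 1 / M) * |G - √(Real.pi / (4 * M))| ≤ 2 * Real.exp (-M) := by
      gcongr <;> linarith
    linarith
  calc _ ≤ Real.exp (2 * M) * (3 * Real.exp (-M)) := by gcongr
    _ = 3 * (Real.exp (2 * M) * Real.exp (-M)) := by ring
    _ = _ := by rw [← Real.exp_add]; ring_nf

/-- The integrand of the main term, scaled so that its saddle point is `1`. -/
noncomputable def saddleIntegrand (M : ℝ) (z : ℂ) : ℂ :=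
  z ^ (1 / 2 : ℂ) * Complex.exp (M * (z + z⁻¹))

lemma differentiableAt_saddleIntegrand (M : ℝ) {z : ℂ} (hz : 0 < z.re) :
    DifferentiableAt ℂ (saddleIntegrand M) z := by
  have h0 : z ≠ 0 := by rintro rfl; simp at hz
  refine DifferentiableAt.mul (DifferentiableAt.cpow_const differentiableAt_id (Or.inl hz)) ?_
  exact ((differentiableAt_id.add (differentiableAt_inv h0)).const_mul _).cexp

lemma norm_saddleIntegrand (M : ℝ) (z : ℂ) :
    ‖saddleIntegrand M z‖ = √‖z‖ * Real.exp (M * (z.re + z.re / ‖z‖ ^ 2)) := by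
  rw [saddleIntegrand, norm_mul, Complex.norm_exp, Complex.re_ofReal_mul, Complex.add_re,
    Complex.inv_re, ← Complex.sq_norm]
  congr 1
  have e2 : (1 / 2 : ℂ) = ((1 / 2 : ℝ) : ℂ) := by push_cast; rfl
  rw [e2, Real.sqrt_eq_rpow]
  rcases eq_or_ne z 0 with rfl | h
  · simp
  · rw [Complex.norm_cpow_of_ne_zero h]
    simp

lemma exists_primitive_saddleIntegrand (M : ℝ) : ∃ F : ℂ → ℂ,
    ∀ z : ℂ, ‖z‖ ^ 2 < 20 * z.re → HasDerivAt F (saddleIntegrand M z) z := by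
  have hb (z : ℂ) : z ∈ Metric.ball (10 : ℂ) 10 ↔ ‖z‖ ^ 2 < 20 * z.re := by
    rw [mem_ball_iff_norm, ← sq_lt_sq₀ (norm_nonneg _) (by norm_num), Complex.sq_norm,
      Complex.sq_norm, Complex.normSq_apply, Complex.normSq_apply]
    simp only [Complex.sub_re, Complex.sub_im, Complex.re_ofNat, Complex.im_ofNat]
    constructor <;> intro h <;> nlinarith
  have hd : DifferentiableOn ℂ (saddleIntegrand M) (Metric.ball 10 10) := fun z hz ↦
    (differentiableAt_saddleIntegrand M (by nlinarith [(hb z).mp hz, sq_nonneg ‖z‖])).differentiableWithinAt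
  obtain ⟨F, hF⟩ := hd.isExactOn_ball
  exact ⟨F, fun z hz ↦ hF z ((hb z).mpr hz)⟩

lemma norm_sub_le_of_saddle {M : ℝ} (hM : 0 ≤ M) {F : ℂ → ℂ}
    (hF : ∀ z : ℂ, ‖z‖ ^ 2 < 20 * z.re → HasDerivAt F (saddleIntegrand M z) z) {σ : ℝ}
    (hσ : σ = 1 ∨ σ = -1) :
    ‖F (1 + (2 * σ : ℝ) * Complex.I) - F (Complex.exp ((Real.pi / 3 * σ : ℝ) * Complex.I))‖ ≤
      3 * Real.exp (5 / 4 * M) := by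
  set S : Set ℂ := {z | 1 / 2 ≤ z.re ∧ z.re ≤ 1 ∧ √3 * z.re ≤ σ * z.im ∧ σ * z.im ≤ 2} with hS
  have hσ2 : σ ^ 2 = 1 := by rcases hσ with rfl | rfl <;> norm_num
  have hs3 : √3 ^ 2 = 3 := Real.sq_sqrt (by norm_num)
  have hs0 : 0 < √3 := by positivity
  have hconv : Convex ℝ S := by
    intro x hx y hy a b ha hb hab
    obtain ⟨x1, x2, x3, x4⟩ := hx
    obtain ⟨y1, y2, y3, y4⟩ := hy
    simp only [hS, Set.mem_ofPred_eq, Complex.add_re, Complex.add_im, Complex.real_smul,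
      Complex.re_ofReal_mul, Complex.im_ofReal_mul]
    have hb' : b = 1 - a := by linarith
    refine ⟨?_, ?_, ?_, ?_⟩ <;> nlinarith
  have hsq (z : ℂ) : ‖z‖ ^ 2 = z.re ^ 2 + (σ * z.im) ^ 2 := by
    rw [Complex.sq_norm, Complex.normSq_apply, mul_pow, hσ2]; ring
  have hbound (z : ℂ) (hz : z ∈ S) : ‖saddleIntegrand M z‖ ≤ 3 / 2 * Real.exp (5 / 4 * M) := by
    obtain ⟨z1, z2, z3, z4⟩ := hz
    have h4 : 4 * z.re ^ 2 ≤ ‖z‖ ^ 2 := by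
      rw [hsq]
      have : (√3 * z.re) ^ 2 ≤ (σ * z.im) ^ 2 := by gcongr
      rw [mul_pow, hs3] at this
      linarith
    have h5 : ‖z‖ ^ 2 ≤ 5 := by
      rw [hsq]
      have : 0 ≤ √3 * z.re := by positivity
      nlinarith
    rw [norm_saddleIntegrand]
    have h6 : √‖z‖ ≤ 3 / 2 := by
      rw [Real.sqrt_le_left (by norm_num)]
      nlinarith [norm_nonneg z]
    have h7 : z.re + z.re / ‖z‖ ^ 2 ≤ 5 / 4 := by
      have : z.re / ‖z‖ ^ 2 ≤ 1 / (4 * z.re) := by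
        rw [div_le_div_iff₀ (by nlinarith) (by linarith)]
        linarith
      have h8 : z.re + 1 / (4 * z.re) ≤ 5 / 4 := by
        rw [← sub_nonneg]
        have : 5 / 4 - (z.re + 1 / (4 * z.re)) = (1 - z.re) * (4 * z.re - 1) / (4 * z.re) := by
          field_simp; ring
        rw [this]
        have : 0 ≤ 1 - z.re := by linarith
        have : 0 ≤ 4 * z.re - 1 := by linarith
        positivity
      linarith
    rw [mul_comm (5 / 4) M]
    gcongr
  have hmem1 : (1 + (2 * σ : ℝ) * Complex.I : ℂ) ∈ S := by
    have : √3 ≤ 2 := by rw [Real.sqrt_le_left (by norm_num)]; norm_num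
    simp only [hS, Set.mem_ofPred_eq, Complex.add_re, Complex.one_re, Complex.re_ofReal_mul,
      Complex.I_re, Complex.add_im, Complex.one_im, Complex.im_ofReal_mul, Complex.I_im]
    refine ⟨by norm_num, by norm_num, by nlinarith, by nlinarith⟩
  have hexp : Complex.exp ((Real.pi / 3 * σ : ℝ) * Complex.I) = ⟨1 / 2, σ * (√3 / 2)⟩ := by
    have hc : Real.cos (Real.pi / 3 * σ) = 1 / 2 := by
      rcases hσ with rfl | rfl <;> simp
    have hs : Real.sin (Real.pi / 3 * σ) = σ * (√3 / 2) := by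
      rcases hσ with rfl | rfl <;> simp
    apply Complex.ext
    · rw [Complex.exp_ofReal_mul_I_re, hc]
    · rw [Complex.exp_ofReal_mul_I_im, hs]
  have hmem2 : Complex.exp ((Real.pi / 3 * σ : ℝ) * Complex.I) ∈ S := by
    rw [hexp]
    have : √3 ≤ 2 := by rw [Real.sqrt_le_left (by norm_num)]; norm_num
    refine ⟨le_rfl, by norm_num, ?_, ?_⟩
    · show √3 * (1 / 2) ≤ σ * (σ * (√3 / 2))
      nlinarith
    · show σ * (σ * (√3 / 2)) ≤ 2
      nlinarith
  have hder (z : ℂ) (hz : z ∈ S) : HasDerivWithinAt F (saddleIntegrand M z) S z := by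
    refine (hF z ?_).hasDerivWithinAt
    obtain ⟨z1, z2, z3, z4⟩ := hz
    rw [hsq]
    have : 0 ≤ √3 * z.re := by positivity
    nlinarith
  have h := hconv.norm_image_sub_le_of_norm_hasDerivWithin_le hder hbound hmem2 hmem1
  refine h.trans ?_
  have hn : ‖(1 + (2 * σ : ℝ) * Complex.I : ℂ) - Complex.exp ((Real.pi / 3 * σ : ℝ) * Complex.I)‖ ≤ 2 := by
    rw [hexp, ← sq_le_sq₀ (norm_nonneg _) (by norm_num), hsq]
    simp only [Complex.add_re, Complex.one_re, Complex.re_ofReal_mul,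
      Complex.I_re, Complex.add_im, Complex.one_im, Complex.im_ofReal_mul, Complex.I_im,
      Complex.sub_re, Complex.sub_im]
    have e : σ * (0 + 2 * σ * 1 - σ * (√3 / 2)) = 2 - √3 / 2 := by
      linear_combination (2 - √3 / 2) * hσ2
    rw [e]
    nlinarith
  calc _ ≤ 3 / 2 * Real.exp (5 / 4 * M) * 2 := by gcongr
    _ = _ := by ring

lemma exp_mul_saddleIntegrand_exp (M : ℝ) {ψ : ℝ} (h : |ψ| ≤ Real.pi / 3) :
    Complex.exp (ψ * Complex.I) * saddleIntegrand M (Complex.exp (ψ * Complex.I)) =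
      Complex.exp ((3 * ψ / 2 : ℝ) * Complex.I) * (Real.exp (2 * M * Real.cos ψ) : ℝ) := by
  have hpi := Real.pi_pos
  have hlog : Complex.log (Complex.exp (ψ * Complex.I)) = ψ * Complex.I := by
    have := abs_le.mp h
    refine Complex.log_exp ?_ ?_ <;> simp <;> linarith
  have e1 : Complex.exp (ψ * Complex.I) + (Complex.exp (ψ * Complex.I))⁻¹ = 2 * Complex.cos ψ := by
    rw [← Complex.exp_neg, Complex.cos, neg_mul]; ring
  rw [saddleIntegrand, Complex.cpow_def_of_ne_zero (Complex.exp_ne_zero _), hlog, e1, ← mul_assoc,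
    ← Complex.exp_add, Complex.ofReal_exp]
  congr 2
  · push_cast; ring
  · push_cast; ring

lemma abs_re_integral_saddleIntegrand_sub_le {M : ℝ} (hM : 1 ≤ M) :
    |(∫ φ in (-2 : ℝ)..2, saddleIntegrand M (1 + φ * Complex.I)).re -
      Real.exp (2 * M) * (√(Real.pi / M) * (1 - 1 / (2 * M)))| ≤ 9 * Real.exp (5 / 4 * M) := by
  obtain ⟨F, hF⟩ := exists_primitive_saddleIntegrand M
  have hpi := Real.pi_pos
  have hI := Complex.I_ne_zero
  have h1 : ∫ φ in (-2 : ℝ)..2, saddleIntegrand M (1 + φ * Complex.I) * Complex.I =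
      F (1 + (2 : ℝ) * Complex.I) - F (1 + (-2 : ℝ) * Complex.I) := by
    have hz (φ : ℝ) : (1 + φ * Complex.I : ℂ).re = 1 := by simp
    refine intervalIntegral.integral_eq_sub_of_hasDerivAt
      (f := fun φ : ℝ ↦ F (1 + φ * Complex.I)) (fun φ hφ ↦ ?_) ?_
    · rw [Set.uIcc_of_le (by norm_num)] at hφ
      have := hF (1 + φ * Complex.I) (by
        rw [Complex.sq_norm, Complex.normSq_apply]
        simp
        nlinarith [hφ.1, hφ.2])
      have h2 : HasDerivAt (fun φ : ℝ ↦ (1 + φ * Complex.I : ℂ)) Complex.I φ := by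
        simpa using ((Complex.ofRealCLM.hasDerivAt (x := φ)).mul_const Complex.I).const_add 1
      exact this.comp φ h2
    · refine (Continuous.mul ?_ continuous_const).intervalIntegrable _ _
      refine continuous_iff_continuousAt.mpr fun φ ↦ ?_
      exact ContinuousAt.comp (g := saddleIntegrand M) (f := fun φ : ℝ ↦ (1 + φ * Complex.I : ℂ))
        (differentiableAt_saddleIntegrand M (by rw [hz]; norm_num)).continuousAt (by fun_prop)
  have h3 : ∫ ψ in (-(Real.pi / 3))..(Real.pi / 3),
      Complex.exp ((3 * ψ / 2 : ℝ) * Complex.I) * (Real.exp (2 * M * Real.cos ψ) : ℝ) * Complex.I =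
      F (Complex.exp ((Real.pi / 3 : ℝ) * Complex.I)) -
        F (Complex.exp ((-(Real.pi / 3) : ℝ) * Complex.I)) := by
    refine intervalIntegral.integral_eq_sub_of_hasDerivAt
      (f := fun φ : ℝ ↦ F (Complex.exp (φ * Complex.I))) (fun ψ hψ ↦ ?_)
      (Continuous.intervalIntegrable (by fun_prop) _ _)
    rw [Set.uIcc_of_le (by linarith)] at hψ
    have habs : |ψ| ≤ Real.pi / 3 := abs_le.mpr hψ
    rw [← exp_mul_saddleIntegrand_exp M habs]
    have := hF (Complex.exp (ψ * Complex.I)) (by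
      rw [Complex.norm_exp_ofReal_mul_I, Complex.exp_ofReal_mul_I_re, ← Real.cos_abs]
      have := Real.cos_le_cos_of_nonneg_of_le_pi (abs_nonneg ψ) (by linarith) habs
      rw [Real.cos_pi_div_three] at this
      linarith)
    have h2 : HasDerivAt (fun φ : ℝ ↦ Complex.exp (φ * Complex.I))
        (Complex.exp (ψ * Complex.I) * Complex.I) ψ := by
      simpa using ((Complex.ofRealCLM.hasDerivAt (x := ψ)).mul_const Complex.I).cexp
    exact (this.comp ψ h2).congr_deriv (by ring)
  have h4 := norm_sub_le_of_saddle (by linarith) hF (σ := 1) (by norm_num)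
  have h5 := norm_sub_le_of_saddle (by linarith) hF (σ := -1) (by norm_num)
  rw [mul_neg_one, mul_neg_one] at h5
  rw [mul_one, mul_one] at h4
  rw [intervalIntegral.integral_mul_const] at h1 h3
  set J := ∫ φ in (-2 : ℝ)..2, saddleIntegrand M (1 + φ * Complex.I)
  set K := ∫ ψ in (-(Real.pi / 3))..(Real.pi / 3),
      Complex.exp ((3 * ψ / 2 : ℝ) * Complex.I) * (Real.exp (2 * M * Real.cos ψ) : ℝ) with hK
  have hJK : ‖J - K‖ ≤ 6 * Real.exp (5 / 4 * M) := by
    have : ‖(J - K) * Complex.I‖ = ‖J - K‖ := by simp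
    rw [← this, sub_mul, h1, h3]
    calc _ = ‖(F (1 + (2 : ℝ) * Complex.I) - F (Complex.exp ((Real.pi / 3 : ℝ) * Complex.I))) -
        (F (1 + (-2 : ℝ) * Complex.I) - F (Complex.exp ((-(Real.pi / 3) : ℝ) * Complex.I)))‖ := by
          congr 1; ring
      _ ≤ _ := (norm_sub_le _ _).trans (by linarith)
  have hKre : K.re = ∫ ψ in (-(Real.pi / 3))..(Real.pi / 3),
      Real.cos (3 * ψ / 2) * Real.exp (2 * M * Real.cos ψ) := by
    have := Complex.reCLM.intervalIntegral_comp_comm (a := -(Real.pi / 3)) (b := Real.pi / 3)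
      (f := fun ψ : ℝ ↦ Complex.exp ((3 * ψ / 2 : ℝ) * Complex.I) * (Real.exp (2 * M * Real.cos ψ) : ℝ))
      (Continuous.intervalIntegrable (by fun_prop) _ _) (μ := MeasureTheory.volume)
    rw [hK, ← Complex.reCLM_apply, ← this]
    refine intervalIntegral.integral_congr fun ψ _ ↦ ?_
    simp only [Complex.reCLM_apply, Complex.re_mul_ofReal, Complex.exp_ofReal_mul_I_re]
  have h6 := abs_integral_cos_mul_exp_cos_sub_le hM
  rw [← hKre] at h6
  have h7 : |J.re - K.re| ≤ 6 * Real.exp (5 / 4 * M) := by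
    rw [← Complex.sub_re]; exact (Complex.abs_re_le_norm _).trans hJK
  have h8 : Real.exp M ≤ Real.exp (5 / 4 * M) := Real.exp_le_exp.mpr (by linarith)
  calc _ ≤ |J.re - K.re| + |K.re - _| := abs_sub_le _ _ _
    _ ≤ _ := by linarith

/-! ### Asymptotics of the partition function with an explicit error term -/

lemma cpow_half_mul_exp_eq_saddleIntegrand {t N M : ℝ} (ht : 0 < t)
    (hA : M * t = Real.pi ^ 2 / 6) (hN : N * t = M) (φ : ℝ) :
    ((t * (1 + φ * Complex.I)) / (2 * Real.pi)) ^ (1 / 2 : ℂ) *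
      Complex.exp (Real.pi ^ 2 / 6 / (t * (1 + φ * Complex.I)) + N * (t * (1 + φ * Complex.I))) =
    √(t / (2 * Real.pi)) * saddleIntegrand M (1 + φ * Complex.I) := by
  have hw : (1 + φ * Complex.I : ℂ) ≠ 0 := by
    intro h; simpa using congrArg Complex.re h
  have hpi := Real.pi_pos
  have htp : 0 < t / (2 * Real.pi) := by positivity
  have ht0 : (t : ℂ) ≠ 0 := mod_cast ht.ne'
  have e1 : (t * (1 + φ * Complex.I)) / (2 * Real.pi) =
      ((t / (2 * Real.pi) : ℝ) : ℂ) * (1 + φ * Complex.I) := by push_cast; ring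
  have e2 : (Real.pi ^ 2 / 6 / (t * (1 + φ * Complex.I)) + N * (t * (1 + φ * Complex.I)) : ℂ) =
      M * ((1 + φ * Complex.I) + (1 + φ * Complex.I)⁻¹) := by
    have hA' : (Real.pi : ℂ) ^ 2 / 6 = M * t := by exact_mod_cast hA.symm
    rw [hA', ← hN]
    push_cast
    field_simp
    ring
  have e3 : (((t / (2 * Real.pi) : ℝ) : ℂ) * (1 + φ * Complex.I)) ^ (1 / 2 : ℂ) =
      √(t / (2 * Real.pi)) * (1 + φ * Complex.I) ^ (1 / 2 : ℂ) := by
    rw [Complex.cpow_def_of_ne_zero (mul_ne_zero (mod_cast htp.ne') hw),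
      Complex.log_ofReal_mul htp hw, add_mul, Complex.exp_add, ← Complex.cpow_def_of_ne_zero hw,
      Real.sqrt_eq_rpow, Real.rpow_def_of_pos htp]
    push_cast
    rfl
  rw [e1, e2, e3, saddleIntegrand, mul_assoc]

lemma sqrt_div_two_pi_le (t : ℝ) : √(t / (2 * Real.pi)) ≤ √t / 2 := by
  have hpi := Real.pi_gt_three
  have h : 2 ≤ √(2 * Real.pi) := Real.le_sqrt_of_sq_le (by linarith)
  rw [Real.sqrt_div' t (by linarith)]
  exact div_le_div_of_nonneg_left (Real.sqrt_nonneg t) two_pos h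

lemma norm_saddleIntegrand_one_add_le {M φ : ℝ} (hM : 0 ≤ M) (hφ : |φ| ≤ 2) :
    ‖saddleIntegrand M (1 + φ * Complex.I)‖ ≤ 3 / 2 * Real.exp (2 * M) := by
  have hn : ‖(1 + φ * Complex.I : ℂ)‖ ^ 2 = 1 + φ ^ 2 := by
    rw [Complex.sq_norm, Complex.normSq_apply]; simp; ring
  have hφ2 : φ ^ 2 ≤ 4 := by nlinarith [sq_abs φ, abs_nonneg φ]
  rw [norm_saddleIntegrand, hn]
  have h1 : √‖(1 + φ * Complex.I : ℂ)‖ ≤ 3 / 2 := by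
    rw [Real.sqrt_le_left (by norm_num)]
    nlinarith [norm_nonneg (1 + φ * Complex.I : ℂ)]
  have h2 : (1 + φ * Complex.I : ℂ).re = 1 := by simp
  have h3 : 1 / (1 + φ ^ 2) ≤ 1 := by
    rw [div_le_one₀ (by positivity)]; linarith [sq_nonneg φ]
  rw [h2, mul_comm 2 M]
  gcongr
  linarith

lemma norm_major_sub_le {t M : ℝ} {n : ℕ} (ht : 0 < t) (hM : 1 ≤ M)
    (hA : M * t = Real.pi ^ 2 / 6) (hN : (n - 1 / 24 : ℝ) * t = M) {φ : ℝ} (hφ : |φ| ≤ 2) :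
    ‖(eulerProd (Complex.exp (-(t + (t * φ : ℝ) * Complex.I))))⁻¹ *
      Complex.exp (n * (t + (t * φ : ℝ) * Complex.I)) -
      √(t / (2 * Real.pi)) * saddleIntegrand M (1 + φ * Complex.I)‖ ≤ 3 / 2 * √t := by
  set z : ℂ := t * (1 + φ * Complex.I) with hz
  have hz1 : (t + (t * φ : ℝ) * Complex.I : ℂ) = z := by rw [hz]; push_cast; ring
  have hzre : z.re = t := by rw [hz, Complex.re_ofReal_mul]; simp
  have hsq : Complex.normSq z = t ^ 2 * (1 + φ ^ 2) := by
    rw [hz, Complex.normSq_mul, Complex.normSq_ofReal, Complex.normSq_apply (1 + _)]; simp; ring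
  have hφ2 : φ ^ 2 ≤ 4 := by nlinarith [sq_abs φ, abs_nonneg φ]
  have htr := inv_eulerProd_cexp_neg (z := z) (by rw [hzre]; exact ht)
  have hs := cpow_half_mul_exp_eq_saddleIntegrand ht hA hN φ
  set f := √(t / (2 * Real.pi)) * saddleIntegrand M (1 + φ * Complex.I) with hf
  set Q := Complex.exp (-(4 * Real.pi ^ 2 / z)) with hQ
  have e1 : (eulerProd (Complex.exp (-z)))⁻¹ * Complex.exp (n * z) - f = f * ((eulerProd Q)⁻¹ - 1) := by
    have e2 : f = (z / (2 * Real.pi)) ^ (1 / 2 : ℂ) *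
        Complex.exp (Real.pi ^ 2 / 6 / z - z / 24) * Complex.exp (n * z) := by
      rw [← hs, mul_assoc, ← Complex.exp_add]
      congr 2
      push_cast
      ring
    rw [htr, mul_sub, mul_one]
    congr 1
    rw [e2]
    ring
  have hQn : ‖Q‖ ≤ Real.exp (-(9 / 2 * M)) := by
    rw [hQ, Complex.norm_exp]
    refine Real.exp_le_exp.mpr ?_
    have : (4 * (Real.pi : ℂ) ^ 2 / z).re = 4 * Real.pi ^ 2 * t / (t ^ 2 * (1 + φ ^ 2)) := by
      rw [show (4 * (Real.pi : ℂ) ^ 2 / z) = ((4 * Real.pi ^ 2 : ℝ) : ℂ) * z⁻¹ by push_cast; ring,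
        Complex.re_ofReal_mul, Complex.inv_re, hsq, hzre]
      ring
    rw [Complex.neg_re, this, neg_le_neg_iff, le_div_iff₀ (by positivity),
      show Real.pi ^ 2 = 6 * (M * t) by linarith]
    have : 0 ≤ M * t ^ 2 := by positivity
    nlinarith
  have hQ1 : ‖Q‖ ≤ Real.exp (-(2 * M)) := hQn.trans (Real.exp_le_exp.mpr (by linarith))
  have hQ2 : ‖Q‖ ≤ 1 / 10 := by
    have h1 : Real.exp (-(9 / 2 * M)) ≤ Real.exp (-(9 / 2)) := Real.exp_le_exp.mpr (by linarith)
    have h2 : Real.exp (-(9 / 2)) ≤ 1 / 10 := by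
      rw [Real.exp_neg, one_div]
      refine inv_anti₀ (by norm_num) ?_
      have := Real.quadratic_le_exp_of_nonneg (x := 9 / 2) (by norm_num)
      linarith
    linarith
  have hb := norm_inv_eulerProd_sub_one_le hQ2
  rw [hz1, e1, norm_mul]
  have hfn : ‖f‖ ≤ √t / 2 * (3 / 2 * Real.exp (2 * M)) := by
    rw [hf, norm_mul, Complex.norm_real, Real.norm_of_nonneg (by positivity)]
    gcongr
    · exact sqrt_div_two_pi_le t
    · exact norm_saddleIntegrand_one_add_le (by linarith) hφ
  calc _ ≤ √t / 2 * (3 / 2 * Real.exp (2 * M)) * (2 * Real.exp (-(2 * M))) := by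
        gcongr; linarith
    _ = 3 / 2 * √t * (Real.exp (2 * M) * Real.exp (-(2 * M))) := by ring
    _ = _ := by rw [← Real.exp_add]; simp

lemma abs_two_pi_mul_partitionFun_sub_le {t M : ℝ} {n : ℕ} (ht : 0 < t) (ht1 : t ≤ 1 / 25)
    (hM : 1 ≤ M) (hA : M * t = Real.pi ^ 2 / 6) (hN : (n - 1 / 24 : ℝ) * t = M) :
    |2 * Real.pi * partitionFun n - t * √(t / (2 * Real.pi)) *
      (Real.exp (2 * M) * (√(Real.pi / M) * (1 - 1 / (2 * M))))| ≤
      2 * Real.pi * √t * Real.exp (31 / 20 * M) + 11 * t * √t * Real.exp (5 / 4 * M) := by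
  have hpi := Real.pi_gt_three
  set Φ : ℝ → ℂ := fun θ ↦ (eulerProd (Complex.exp (-(t + θ * Complex.I))))⁻¹ *
        Complex.exp (n * (t + θ * Complex.I)) with hΦ
  have hcont : Continuous Φ := (continuous_inv_eulerProd_cexp ht).mul (by fun_prop)
  have hint (a b : ℝ) : IntervalIntegrable Φ MeasureTheory.volume a b := hcont.intervalIntegrable a b
  have hp : (2 * Real.pi * partitionFun n : ℂ) = ∫ θ in (-Real.pi)..Real.pi, Φ θ :=
    partitionFun_eq_integral n ht
  have hminor (θ : ℝ) (h2 : 2 * t ≤ |θ|) (h3 : |θ| ≤ Real.pi) :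
      ‖Φ θ‖ ≤ √t * Real.exp (31 / 20 * M) := by
    have h := norm_inv_eulerProd_le_of_minor ht ht1 h2 h3
    have h4 : ‖Complex.exp (n * (t + θ * Complex.I))‖ = Real.exp (n * t) := by
      rw [Complex.norm_exp]; simp
    rw [hΦ, norm_mul, h4]
    refine (mul_le_mul_of_nonneg_right h (Real.exp_pos _).le).trans ?_
    rw [mul_assoc, ← Real.exp_add]
    gcongr
    have h5 : Real.pi ^ 2 / 6 / t = M := by rw [← hA]; field_simp
    have h6 : 9 / 20 * M ≤ 3 / 4 / t := by
      rw [le_div_iff₀ ht, mul_assoc, hA]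
      have := Real.pi_lt_d2
      nlinarith
    rw [h5]
    linarith
  have hb1 : ‖∫ θ in (-Real.pi)..(-(2 * t)), Φ θ‖ ≤
      √t * Real.exp (31 / 20 * M) * |-(2 * t) - -Real.pi| := by
    refine intervalIntegral.norm_integral_le_of_norm_le_const fun θ hθ ↦ ?_
    rw [Set.uIoc_of_le (by linarith)] at hθ
    have : |θ| = -θ := abs_of_neg (by linarith [hθ.2])
    exact hminor θ (by linarith [hθ.2]) (by linarith [hθ.1])
  have hb2 : ‖∫ θ in (2 * t)..Real.pi, Φ θ‖ ≤
      √t * Real.exp (31 / 20 * M) * |Real.pi - 2 * t| := by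
    refine intervalIntegral.norm_integral_le_of_norm_le_const fun θ hθ ↦ ?_
    rw [Set.uIoc_of_le (by linarith)] at hθ
    have : |θ| = θ := abs_of_pos (by linarith [hθ.1])
    exact hminor θ (by linarith [hθ.1]) (by linarith [hθ.2])
  rw [abs_of_pos (by linarith)] at hb1 hb2
  set J := ∫ φ in (-2 : ℝ)..2, saddleIntegrand M (1 + φ * Complex.I) with hJ
  have hsc : ∫ θ in (-(2 * t))..(2 * t), Φ θ = t * ∫ φ in (-2 : ℝ)..2, Φ (t * φ) := by
    rw [intervalIntegral.integral_comp_mul_left _ ht.ne', Complex.real_smul, ← mul_assoc,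
      ← Complex.ofReal_mul, mul_inv_cancel₀ ht.ne']
    simp [mul_comm]
  have hcs : Continuous fun φ : ℝ ↦ saddleIntegrand M (1 + φ * Complex.I) := by
    refine continuous_iff_continuousAt.mpr fun φ ↦ ?_
    exact ContinuousAt.comp (g := saddleIntegrand M) (f := fun φ : ℝ ↦ (1 + φ * Complex.I : ℂ))
      (differentiableAt_saddleIntegrand M (by simp)).continuousAt (by fun_prop)
  have hb3 : ‖(∫ φ in (-2 : ℝ)..2, Φ (t * φ)) - √(t / (2 * Real.pi)) * J‖ ≤
      3 / 2 * √t * |2 - (-2)| := by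
    have i1 : IntervalIntegrable (fun φ : ℝ ↦ Φ (t * φ)) MeasureTheory.volume (-2) 2 :=
      (hcont.comp (continuous_const.mul continuous_id)).intervalIntegrable _ _
    have i2 : IntervalIntegrable (fun φ : ℝ ↦ (√(t / (2 * Real.pi)) : ℂ) *
        saddleIntegrand M (1 + φ * Complex.I)) MeasureTheory.volume (-2) 2 :=
      (continuous_const.mul hcs).intervalIntegrable _ _
    rw [hJ, ← intervalIntegral.integral_const_mul, ← intervalIntegral.integral_sub i1 i2]
    refine intervalIntegral.norm_integral_le_of_norm_le_const fun φ hφ ↦ ?_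
    rw [Set.uIoc_of_le (by norm_num)] at hφ
    exact norm_major_sub_le ht hM hA hN (abs_le.mpr ⟨hφ.1.le, hφ.2⟩)
  have htot : ‖(2 * Real.pi * partitionFun n : ℂ) - t * (√(t / (2 * Real.pi)) * J)‖ ≤
      2 * Real.pi * √t * Real.exp (31 / 20 * M) + 6 * t * √t := by
    have e1 : (2 * Real.pi * partitionFun n : ℂ) - t * (√(t / (2 * Real.pi)) * J) =
        (∫ θ in (-Real.pi)..(-(2 * t)), Φ θ) + (∫ θ in (2 * t)..Real.pi, Φ θ) +
        t * ((∫ φ in (-2 : ℝ)..2, Φ (t * φ)) - √(t / (2 * Real.pi)) * J) := by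
      rw [mul_sub, ← hsc, hp,
        ← intervalIntegral.integral_add_adjacent_intervals (hint _ (-(2 * t))) (hint _ Real.pi),
        ← intervalIntegral.integral_add_adjacent_intervals (hint (-(2 * t)) (2 * t)) (hint _ Real.pi)]
      ring
    rw [e1]
    refine (norm_add₃_le).trans ?_
    rw [norm_mul, Complex.norm_real, Real.norm_of_nonneg ht.le]
    norm_num at hb3
    have h7 : 0 ≤ √t * Real.exp (31 / 20 * M) := by positivity
    have h8 := mul_le_mul_of_nonneg_left hb3 ht.le
    nlinarith [mul_nonneg h7 ht.le]
  have hre : |2 * Real.pi * partitionFun n - t * √(t / (2 * Real.pi)) * J.re| ≤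
      2 * Real.pi * √t * Real.exp (31 / 20 * M) + 6 * t * √t := by
    refine le_trans ?_ htot
    refine le_trans (le_of_eq ?_) (Complex.abs_re_le_norm _)
    congr 1
    rw [← mul_assoc, ← Complex.ofReal_mul, Complex.sub_re, Complex.re_ofReal_mul]
    congr 1
    norm_cast
  have hJ9 := abs_re_integral_saddleIntegrand_sub_le hM
  rw [← hJ] at hJ9
  set X := Real.exp (2 * M) * (√(Real.pi / M) * (1 - 1 / (2 * M)))
  have h9 : |t * √(t / (2 * Real.pi)) * J.re - t * √(t / (2 * Real.pi)) * X| ≤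
      t * (√t / 2) * (9 * Real.exp (5 / 4 * M)) := by
    rw [← mul_sub, abs_mul, abs_of_nonneg (by positivity : 0 ≤ t * √(t / (2 * Real.pi)))]
    gcongr
    exact sqrt_div_two_pi_le t
  have h10 : 6 * t * √t ≤ 6 * t * √t * Real.exp (5 / 4 * M) :=
    le_mul_of_one_le_right (by positivity) (Real.one_le_exp (by linarith))
  have h11 : 0 ≤ t * √t * Real.exp (5 / 4 * M) := by positivity
  calc _ ≤ _ := abs_sub_le _ (t * √(t / (2 * Real.pi)) * J.re) _
    _ ≤ _ := by linarith

/-- The leading term of `2 π p(n)`, as a function of `√(π² (n - 1/24) / 6)`. -/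
noncomputable def partitionMain (M : ℝ) : ℝ :=
  Real.pi ^ 2 / 6 * √(Real.pi ^ 2 / 6 / 2) * ((1 - 1 / (2 * M)) / M ^ 2 * Real.exp (2 * M))

lemma pow_six_mul_le_exp {M : ℝ} (hM : 64 ≤ M) : 29 * M ^ 6 ≤ Real.exp (9 / 20 * M) := by
  have h1 : M / 64 ≤ Real.exp (M / 64 - 1) := by linarith [Real.add_one_le_exp (M / 64 - 1)]
  have h2 : (M / 64) ^ 6 ≤ Real.exp (6 * (M / 64 - 1)) := by
    rw [show (6 : ℝ) * (M / 64 - 1) = (6 : ℕ) * (M / 64 - 1) by norm_num, Real.exp_nat_mul]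
    exact pow_le_pow_left₀ (by positivity) h1 6
  have h3 : (29 * 64 ^ 6 : ℝ) ≤ Real.exp (144 / 5) := by
    have e1 : Real.exp (144 / 5) = Real.exp 1 ^ 28 * Real.exp (4 / 5) := by
      rw [← Real.exp_nat_mul, ← Real.exp_add]; norm_num
    have e2 : (2.7182818283 : ℝ) ^ 28 ≤ Real.exp 1 ^ 28 :=
      pow_le_pow_left₀ (by norm_num) Real.exp_one_gt_d9.le 28
    have e3 : (9 / 5 : ℝ) ≤ Real.exp (4 / 5) := by linarith [Real.add_one_le_exp (4 / 5 : ℝ)]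
    rw [e1]
    calc (29 * 64 ^ 6 : ℝ) ≤ 2.7182818283 ^ 28 * (9 / 5) := by norm_num
      _ ≤ _ := by gcongr
  calc 29 * M ^ 6 = 29 * 64 ^ 6 * (M / 64) ^ 6 := by ring
    _ ≤ Real.exp (144 / 5) * Real.exp (6 * (M / 64 - 1)) := by gcongr
    _ = Real.exp (144 / 5 + 6 * (M / 64 - 1)) := (Real.exp_add _ _).symm
    _ ≤ _ := Real.exp_le_exp.mpr (by linarith)

lemma partitionMain_pos {M : ℝ} (hM : 1 ≤ M) : 0 < partitionMain M := by
  have h : 1 / (2 * M) < 1 := by rw [div_lt_one (by linarith)]; linarith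
  have h2 : 0 < 1 - 1 / (2 * M) := by linarith
  have := Real.pi_pos
  unfold partitionMain
  positivity

/-- The first terms of the asymptotic expansion of `p(n)`, with an explicit error bound. -/
lemma abs_two_pi_mul_partitionFun_sub_partitionMain_le {M : ℝ} {n : ℕ} (hM : 64 ≤ M)
    (hN : (n - 1 / 24 : ℝ) * (Real.pi ^ 2 / 6) = M ^ 2) :
    |2 * Real.pi * partitionFun n - partitionMain M| ≤ partitionMain M / (40 * M ^ 4) := by
  have hpi := Real.pi_gt_d2
  have hpi2 := Real.pi_lt_d2
  unfold partitionMain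
  set A := Real.pi ^ 2 / 6 with hA
  have hA1 : 1.64 < A := by rw [hA]; nlinarith
  have hA2 : A < 1.66 := by rw [hA]; nlinarith
  have hM0 : 0 < M := by linarith
  have ht : 0 < A / M := by positivity
  have key := abs_two_pi_mul_partitionFun_sub_le (t := A / M) (M := M) (n := n) ht
    (by rw [div_le_iff₀ hM0]; linarith) (by linarith) (by rw [← hA]; field_simp)
    (by rw [← mul_div_assoc, hN]; field_simp)
  have e1 : A / M * √(A / M / (2 * Real.pi)) *
      (Real.exp (2 * M) * (√(Real.pi / M) * (1 - 1 / (2 * M)))) =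
      A * √(A / 2) * ((1 - 1 / (2 * M)) / M ^ 2 * Real.exp (2 * M)) := by
    have : √(A / M / (2 * Real.pi)) * √(Real.pi / M) = √(A / 2) / M := by
      rw [← Real.sqrt_mul (by positivity),
        show A / M / (2 * Real.pi) * (Real.pi / M) = A / 2 / M ^ 2 by field_simp,
        Real.sqrt_div (by positivity), Real.sqrt_sq hM0.le]
    calc _ = A / M * (√(A / M / (2 * Real.pi)) * √(Real.pi / M)) *
          (Real.exp (2 * M) * (1 - 1 / (2 * M))) := by ring
      _ = _ := by rw [this]; field_simp
  rw [e1] at key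
  refine key.trans ?_
  have hsM : √(A / M) ≤ √A / 8 := by
    rw [Real.sqrt_div (by positivity)]
    exact div_le_div_of_nonneg_left (Real.sqrt_nonneg A) (by norm_num)
      (Real.le_sqrt_of_sq_le (by linarith))
  have hs2 : √A * (7 / 10) ≤ √(A / 2) := by
    apply Real.le_sqrt_of_sq_le
    rw [mul_pow, Real.sq_sqrt (by positivity)]
    linarith
  have hexp : Real.exp (5 / 4 * M) ≤ Real.exp (31 / 20 * M) :=
    Real.exp_le_exp.mpr (by linarith)
  have hAM : A / M ≤ 1 / 38 := by
    rw [div_le_iff₀ hM0]; linarith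
  have hexp2 : 29 * M ^ 6 * Real.exp (31 / 20 * M) ≤ Real.exp (2 * M) := by
    rw [show 2 * M = 9 / 20 * M + 31 / 20 * M by ring, Real.exp_add]
    gcongr
    exact pow_six_mul_le_exp hM
  have hM1 : 127 / 128 ≤ 1 - 1 / (2 * M) := by
    have : 1 / (2 * M) ≤ 1 / 128 := one_div_le_one_div_of_le (by norm_num) (by linarith)
    linarith
  calc 2 * Real.pi * √(A / M) * Real.exp (31 / 20 * M) +
        11 * (A / M) * √(A / M) * Real.exp (5 / 4 * M)
      ≤ 2 * 3.15 * (√A / 8) * Real.exp (31 / 20 * M) +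
        11 * (1 / 38) * (√A / 8) * Real.exp (31 / 20 * M) := by gcongr
    _ ≤ 1.64 * (√A * (7 / 10)) * (127 / 128 * (29 * Real.exp (31 / 20 * M))) / 40 := by
        have : 0 ≤ √A * Real.exp (31 / 20 * M) := by positivity
        linarith
    _ = 1.64 * (√A * (7 / 10)) * (127 / 128 / M ^ 2 * (29 * M ^ 6 * Real.exp (31 / 20 * M))) /
        (40 * M ^ 4) := by field_simp
    _ ≤ _ := by gcongr

lemma le_sqrt_one_add {x : ℝ} (hx : |x| ≤ 1 / 4) :
    1 + x / 2 - x ^ 2 / 8 + x ^ 3 / 16 - x ^ 4 / 16 ≤ √(1 + x) := by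
  obtain ⟨h1, h2⟩ := abs_le.mp hx
  apply Real.le_sqrt_of_sq_le
  have e : (1 + x / 2 - x ^ 2 / 8 + x ^ 3 / 16 - x ^ 4 / 16) ^ 2 =
      1 + x - x ^ 4 * (3 / 64 + 5 * x / 64 - 5 * x ^ 2 / 256 + x ^ 3 / 128 - x ^ 4 / 256) := by
    ring
  have h3 : 0 ≤ 3 / 64 + 5 * x / 64 - 5 * x ^ 2 / 256 + x ^ 3 / 128 - x ^ 4 / 256 := by
    have h4 : x ^ 2 ≤ 1 / 16 := by nlinarith
    nlinarith [mul_nonneg (sq_nonneg x) (by linarith : 0 ≤ x + 1 / 4),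
      mul_nonneg (sq_nonneg x) (by linarith : 0 ≤ 1 / 16 - x ^ 2)]
  rw [e]
  nlinarith [mul_nonneg (by positivity : 0 ≤ x ^ 4) h3]

lemma sqrt_one_add_le {x : ℝ} (hx : |x| ≤ 1 / 4) :
    √(1 + x) ≤ 1 + x / 2 - x ^ 2 / 8 + x ^ 3 / 16 := by
  obtain ⟨h1, h2⟩ := abs_le.mp hx
  have h4 : x ^ 2 ≤ 1 / 16 := by nlinarith
  have h5 := mul_nonneg (sq_nonneg x) (by linarith : 0 ≤ x + 1 / 4)
  refine Real.sqrt_le_iff.mpr ⟨by nlinarith, ?_⟩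
  have e : (1 + x / 2 - x ^ 2 / 8 + x ^ 3 / 16) ^ 2 =
      1 + x + x ^ 4 * (5 / 64 - x / 64 + x ^ 2 / 256) := by
    ring
  rw [e]
  nlinarith [mul_nonneg (by positivity : 0 ≤ x ^ 4)
    (by nlinarith : 0 ≤ 5 / 64 - x / 64 + x ^ 2 / 256)]

lemma inv_sqrt_one_add_le {x : ℝ} (hx : |x| ≤ 1 / 4) : (√(1 + x))⁻¹ ≤ 1 - x / 2 + x ^ 2 / 2 := by
  obtain ⟨h1, h2⟩ := abs_le.mp hx
  have h0 : 0 < 1 - x / 2 + x ^ 2 / 2 := by nlinarith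
  refine inv_le_of_inv_le₀ h0 (Real.le_sqrt_of_sq_le ?_)
  rw [inv_pow]
  refine inv_le_of_inv_le₀ (by linarith) ?_
  rw [inv_le_iff_one_le_mul₀ (by linarith)]
  have e : (1 - x / 2 + x ^ 2 / 2) ^ 2 * (1 + x) =
      1 + x ^ 2 * (1 / 4 + 3 * x / 4 - x ^ 2 / 4 + x ^ 3 / 4) := by ring
  have h4 : x ^ 2 ≤ 1 / 16 := by nlinarith
  have h5 := mul_nonneg (sq_nonneg x) (by linarith : 0 ≤ x + 1 / 4)
  have h6 : 0 ≤ 1 / 4 + 3 * x / 4 - x ^ 2 / 4 + x ^ 3 / 4 := by nlinarith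
  rw [e]
  nlinarith [mul_nonneg (sq_nonneg x) h6]

lemma partitionMain_mul_partitionMain {M r s x : ℝ} (h : (r * s) ^ 2 = 1 - x ^ 2) :
    partitionMain (M * r) * partitionMain (M * s) =
      (Real.pi ^ 2 / 6 * √(Real.pi ^ 2 / 6 / 2)) ^ 2 / M ^ 4 *
        ((1 - 1 / (2 * M) * r⁻¹) * (1 - 1 / (2 * M) * s⁻¹) / (1 - x ^ 2) *
          Real.exp (2 * M * (r + s))) := by
  rw [← h, mul_add, Real.exp_add]
  unfold partitionMain
  simp only [div_eq_mul_inv, mul_inv, mul_pow, one_mul]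
  ring_nf

lemma one_sub_sq_div_ten_le {x y : ℝ} (hx0 : 0 ≤ x) (hx : x ≤ 1 / 2500) (hy0 : 0 ≤ y)
    (hy : y ≤ 1 / 38) :
    1 - x ^ 2 / 10 ≤ (1 - (y * x / 2 + y * x ^ 3 / 4)) * (1 + y * x / 2 * (1 - x / 12)) := by
  have hyx : y * x ≤ 1 / 38 * (1 / 2500) := by gcongr
  have hy2 : y ^ 2 ≤ (1 / 38) ^ 2 := by gcongr
  have hδ : y * x / 2 * (1 - x / 12) ≤ y * x / 2 * 1 := by gcongr; linarith
  have hδ0 : 0 ≤ y * x / 2 * (1 - x / 12) := mul_nonneg (by positivity) (by linarith)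
  have hD : y * x / 2 + y * x ^ 3 / 4 ≤ y * x := by
    have : y * x * x ^ 2 ≤ y * x * 1 := by gcongr; nlinarith
    linarith
  have hDδ := mul_le_mul hD hδ hδ0 (by positivity)
  have h : x ^ 2 * (y / 24 + y * x / 4 + y ^ 2 / 2) ≤ x ^ 2 * (1 / 10) := by gcongr; linarith
  linarith

/-- A lower bound for the log-concavity ratio of the main term of `p(n)`. -/
lemma sq_partitionMain_mul_le {M x : ℝ} (hM : 64 ≤ M) (hx0 : 0 < x) (hx : x ≤ 1 / 2500)
    (hMx : M ^ 2 * x ≤ 1.66) :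
    partitionMain M ^ 2 * ((1 + x ^ 2) * (1 - x ^ 2 / 10) ^ 2) ≤
      partitionMain (M * √(1 + x)) * partitionMain (M * √(1 - x)) *
        (1 + M * x ^ 2 / 2 * (1 - x / 12)) := by
  have hM0 : 0 < M := by linarith
  have hx1 : |x| ≤ 1 / 4 := abs_le.mpr ⟨by linarith, by linarith⟩
  have hx2 : |-x| ≤ 1 / 4 := by rwa [abs_neg]
  have hr := le_sqrt_one_add hx1
  have hs := le_sqrt_one_add hx2
  have hir := inv_sqrt_one_add_le hx1
  have his := inv_sqrt_one_add_le hx2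
  rw [← sub_eq_add_neg] at hs his
  have hxx : x ^ 2 ≤ 1 / 100 := by nlinarith
  have hrs : (√(1 + x) * √(1 - x)) ^ 2 = 1 - x ^ 2 := by
    rw [mul_pow, Real.sq_sqrt (by linarith), Real.sq_sqrt (by linarith)]; ring
  have hrs1 : √(1 + x) * √(1 - x) ≤ 1 := by
    refine (sq_le_one_iff₀ (by positivity)).mp ?_
    rw [hrs]; linarith [sq_nonneg x]
  have hrpos : 0 < √(1 + x) := Real.sqrt_pos.mpr (by linarith)
  have hspos : 0 < √(1 - x) := Real.sqrt_pos.mpr (by linarith)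
  have hMM : partitionMain M ^ 2 = partitionMain (M * 1) * partitionMain (M * 1) := by
    rw [mul_one, sq]
  rw [hMM, partitionMain_mul_partitionMain (x := 0) (by norm_num),
    partitionMain_mul_partitionMain hrs]
  generalize √(1 + x) = r at *
  generalize √(1 - x) = s at *
  have ha0 : 0 < 1 / (2 * M) := by positivity
  have ha1 : 1 / (2 * M) ≤ 1 / 128 := one_div_le_one_div_of_le (by norm_num) (by linarith)
  generalize 1 / (2 * M) = a at *
  have hMx1 : M * x ≤ 1 / 38 := by nlinarith
  have hD := one_sub_sq_div_ten_le hx0.le hx (mul_pos hM0 hx0).le hMx1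
  rw [show M * x * x / 2 * (1 - x / 12) = M * x ^ 2 / 2 * (1 - x / 12) by ring] at hD
  have hδ0 : 0 ≤ 1 + M * x ^ 2 / 2 * (1 - x / 12) := by
    have : 0 ≤ 1 - x / 12 := by linarith
    positivity
  generalize 1 + M * x ^ 2 / 2 * (1 - x / 12) = δ at *
  have hexp : Real.exp (2 * M * (1 + 1)) * (1 - (M * x * x / 2 + M * x * x ^ 3 / 4)) ≤
      Real.exp (2 * M * (r + s)) := by
    calc _ ≤ Real.exp (2 * M * (1 + 1)) * Real.exp (-(M * x * x / 2 + M * x * x ^ 3 / 4)) := by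
          gcongr
          exact Real.one_sub_le_exp_neg _
      _ = Real.exp (2 * M * (1 + 1) - (M * x * x / 2 + M * x * x ^ 3 / 4)) := by
        rw [← Real.exp_add]; ring_nf
      _ ≤ _ := by
        apply Real.exp_le_exp.mpr
        have := mul_le_mul_of_nonneg_left (add_le_add hr hs) (by linarith : 0 ≤ 2 * M)
        linarith
  have hmid : (1 - a) ^ 2 * (1 - x ^ 2 / 10) ≤ (1 - a * r⁻¹) * (1 - a * s⁻¹) := by
    have h1 : 1 ≤ r⁻¹ * s⁻¹ := by
      rw [← mul_inv]; exact (one_le_inv₀ (by positivity)).mpr hrs1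
    have h2 := mul_le_mul_of_nonneg_left (add_le_add hir his) ha0.le
    have h3 := mul_le_mul_of_nonneg_left h1 (sq_nonneg a)
    have h4 : a * x ^ 2 ≤ 1 / 128 * x ^ 2 := by gcongr
    have h5 : (127 / 128) ^ 2 ≤ (1 - a) ^ 2 := by gcongr; linarith
    have h6 := mul_le_mul_of_nonneg_right h5 (sq_nonneg x)
    linarith [sq_nonneg x]
  have hinv : 1 + x ^ 2 ≤ (1 - x ^ 2)⁻¹ := by
    rw [← one_div, le_div_iff₀ (by linarith)]
    nlinarith [sq_nonneg (x ^ 2)]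
  generalize hc : (Real.pi ^ 2 / 6 * √(Real.pi ^ 2 / 6 / 2)) ^ 2 / M ^ 4 = c
  have hc0 : 0 ≤ c := by rw [← hc]; positivity
  have hi0 : 0 ≤ (1 - x ^ 2)⁻¹ := inv_nonneg.mpr (by linarith)
  have hm0 : 0 ≤ (1 - a * r⁻¹) * (1 - a * s⁻¹) :=
    le_trans (mul_nonneg (sq_nonneg _) (by linarith)) hmid
  have hx10 : 0 ≤ 1 - x ^ 2 / 10 := by linarith
  calc _ = c * ((1 - a) ^ 2 * (1 - x ^ 2 / 10) * (1 + x ^ 2) *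
        (Real.exp (2 * M * (1 + 1)) * (1 - x ^ 2 / 10))) := by norm_num; ring
    _ ≤ c * ((1 - a * r⁻¹) * (1 - a * s⁻¹) * (1 - x ^ 2)⁻¹ * (Real.exp (2 * M * (1 + 1)) *
        ((1 - (M * x * x / 2 + M * x * x ^ 3 / 4)) * δ))) := by gcongr
    _ = c * ((1 - a * r⁻¹) * (1 - a * s⁻¹) * (1 - x ^ 2)⁻¹ * (Real.exp (2 * M * (1 + 1)) *
        (1 - (M * x * x / 2 + M * x * x ^ 3 / 4)) * δ)) := by ring
    _ ≤ c * ((1 - a * r⁻¹) * (1 - a * s⁻¹) * (1 - x ^ 2)⁻¹ *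
        (Real.exp (2 * M * (r + s)) * δ)) := by gcongr
    _ = _ := by rw [div_eq_mul_inv]; ring

/-- An upper bound for the log-concavity ratio of the main term of `p(n)`. -/
lemma partitionMain_mul_partitionMain_mul_le {M x : ℝ} (hM : 64 ≤ M) (hx0 : 0 < x)
    (hx : x ≤ 1 / 2500) :
    partitionMain (M * √(1 + x)) * partitionMain (M * √(1 - x)) *
      ((1 - x ^ 2) * (1 + 32 * x ^ 2)) ≤ partitionMain M ^ 2 := by
  have hM0 : 0 < M := by linarith
  have hx1 : |x| ≤ 1 / 4 := abs_le.mpr ⟨by linarith, by linarith⟩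
  have hx2 : |-x| ≤ 1 / 4 := by rwa [abs_neg]
  have hr := sqrt_one_add_le hx1
  have hs := sqrt_one_add_le hx2
  rw [← sub_eq_add_neg] at hs
  have hxx : x ^ 2 ≤ 1 / 100 := by nlinarith
  have hrs : (√(1 + x) * √(1 - x)) ^ 2 = 1 - x ^ 2 := by
    rw [mul_pow, Real.sq_sqrt (by linarith), Real.sq_sqrt (by linarith)]; ring
  have hrs1 : √(1 + x) * √(1 - x) ≤ 1 := by
    refine (sq_le_one_iff₀ (by positivity)).mp ?_
    rw [hrs]; linarith [sq_nonneg x]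
  have hrpos : 1 / 2 ≤ √(1 + x) := Real.le_sqrt_of_sq_le (by linarith)
  have hspos : 1 / 2 ≤ √(1 - x) := Real.le_sqrt_of_sq_le (by linarith)
  have hMM : partitionMain M ^ 2 = partitionMain (M * 1) * partitionMain (M * 1) := by
    rw [mul_one, sq]
  rw [hMM, partitionMain_mul_partitionMain hrs,
    partitionMain_mul_partitionMain (x := 0) (by norm_num)]
  generalize √(1 + x) = r at *
  generalize √(1 - x) = s at *
  have ha0 : 0 < 1 / (2 * M) := by positivity
  have ha1 : 1 / (2 * M) ≤ 1 / 128 := one_div_le_one_div_of_le (by norm_num) (by linarith)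
  generalize 1 / (2 * M) = a at *
  have hexp : Real.exp (2 * M * (r + s)) * (1 + 32 * x ^ 2) ≤ Real.exp (2 * M * (1 + 1)) := by
    calc _ ≤ Real.exp (2 * M * (r + s)) * Real.exp (32 * x ^ 2) := by
          gcongr
          linarith [Real.add_one_le_exp (32 * x ^ 2)]
      _ = Real.exp (2 * M * (r + s) + 32 * x ^ 2) := by rw [← Real.exp_add]
      _ ≤ _ := by
        apply Real.exp_le_exp.mpr
        have h1 := mul_le_mul_of_nonneg_left (add_le_add hr hs) (by linarith : 0 ≤ 2 * M)
        have h2 := mul_le_mul_of_nonneg_right hM (sq_nonneg x)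
        linarith
  have hri : r⁻¹ ≤ 2 := inv_le_of_inv_le₀ (by norm_num) (by linarith)
  have hsi : s⁻¹ ≤ 2 := inv_le_of_inv_le₀ (by norm_num) (by linarith)
  have h1 : 1 ≤ r⁻¹ * s⁻¹ := by
    rw [← mul_inv]; exact (one_le_inv₀ (by positivity)).mpr hrs1
  have hri0 : 0 < r⁻¹ := inv_pos.mpr (by linarith)
  have hsi0 : 0 < s⁻¹ := inv_pos.mpr (by linarith)
  generalize r⁻¹ = r' at *
  generalize s⁻¹ = s' at *
  have hrs2 : 2 ≤ r' + s' := by nlinarith [sq_nonneg (r' - s')]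
  have hmid : (1 - a * r') * (1 - a * s') ≤ (1 - a) ^ 2 := by
    have h2 : (1 - a * ((r' + s') / 2)) ^ 2 ≤ (1 - a * 1) ^ 2 := by
      gcongr
      · nlinarith
      · linarith
    nlinarith [sq_nonneg (a * (r' - s'))]
  generalize hc : (Real.pi ^ 2 / 6 * √(Real.pi ^ 2 / 6 / 2)) ^ 2 / M ^ 4 = c
  have hc0 : 0 ≤ c := by rw [← hc]; positivity
  have hx1 : 1 - x ^ 2 ≠ 0 := by linarith
  calc _ = c * ((1 - a * r') * (1 - a * s') *
        (Real.exp (2 * M * (r + s)) * (1 + 32 * x ^ 2))) := by field_simp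
    _ ≤ c * ((1 - a) ^ 2 * Real.exp (2 * M * (1 + 1))) := by gcongr
    _ = _ := by rw [inv_one]; ring

lemma abs_sub_partitionMain_le_of_sq {M x : ℝ} {n : ℕ} (hM : 64 ≤ M)
    (hMx : 8 / 5 ≤ M ^ 2 * x)
    (hN : (n - 1 / 24 : ℝ) * (Real.pi ^ 2 / 6) = M ^ 2) :
    |2 * Real.pi * partitionFun n - partitionMain M| ≤ partitionMain M * (x ^ 2 / 100) := by
  refine (abs_two_pi_mul_partitionFun_sub_partitionMain_le hM hN).trans ?_
  rw [div_eq_mul_inv]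
  refine mul_le_mul_of_nonneg_left ?_ (partitionMain_pos (by linarith)).le
  rw [inv_le_iff_one_le_mul₀ (by positivity)]
  nlinarith

lemma mul_sq_div_two_le {x M : ℝ} {n : ℕ} (hx0 : 0 < x) (hn : x * (n - 1 / 24) = 1) (hM : 0 ≤ M)
    (hMx : M ^ 2 * x = Real.pi ^ 2 / 6) :
    M * x ^ 2 / 2 * (1 - x / 12) ≤ Real.pi / (√24 * (n : ℝ) ^ (3 / 2 : ℝ)) := by
  have hpi := Real.pi_pos
  have hn0 : (0 : ℝ) < n := by nlinarith
  have hnx : (n : ℝ) = x⁻¹ * (1 + x / 24) := by field_simp; linarith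
  have hpow : (n : ℝ) ^ (3 / 2 : ℝ) = n * √n := by
    rw [show (3 / 2 : ℝ) = 1 + 1 / 2 by norm_num, Real.rpow_add hn0, Real.rpow_one,
      Real.sqrt_eq_rpow]
  have hMs : M * √x = √(Real.pi ^ 2 / 6) := by
    rw [← hMx, Real.sqrt_mul (sq_nonneg M), Real.sqrt_sq hM]
  have h24 : √24 * (M * √x) = 2 * Real.pi := by
    rw [hMs, ← Real.sqrt_mul (by norm_num), show 24 * (Real.pi ^ 2 / 6) = (2 * Real.pi) ^ 2 by ring,
      Real.sqrt_sq (by positivity)]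
  have hsn : √(n : ℝ) ≤ (√x)⁻¹ * (1 + x / 24) := by
    rw [hnx, Real.sqrt_mul (by positivity), Real.sqrt_inv]
    gcongr
    exact Real.sqrt_le_iff.mpr ⟨by positivity, by nlinarith⟩
  rw [le_div_iff₀ (by positivity), hpow]
  have hsx : √x ^ 2 = x := Real.sq_sqrt hx0.le
  have hsx0 : 0 < √x := Real.sqrt_pos.mpr hx0
  by_cases hx12 : 1 - x / 12 ≤ 0
  · refine le_trans (mul_nonpos_of_nonpos_of_nonneg ?_ (by positivity)) hpi.le
    exact mul_nonpos_of_nonneg_of_nonpos (by positivity) hx12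
  · push Not at hx12
    calc M * x ^ 2 / 2 * (1 - x / 12) * (√24 * (n * √n))
        ≤ M * x ^ 2 / 2 * (1 - x / 12) * (√24 * (n * ((√x)⁻¹ * (1 + x / 24)))) := by gcongr
      _ = M * √x ^ 2 * x / 2 * (1 - x / 12) *
          (√24 * (x⁻¹ * (1 + x / 24) * ((√x)⁻¹ * (1 + x / 24)))) := by rw [hnx, hsx]; ring
      _ = √24 * (M * √x) / 2 * ((1 - x / 12) * (1 + x / 24) ^ 2) := by field_simp
      _ ≤ √24 * (M * √x) / 2 * 1 := by
        gcongr
        nlinarith [mul_nonneg hx0.le (sq_nonneg x), sq_nonneg x]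
      _ = Real.pi := by rw [h24]; ring

lemma mul_lt_sq_and_sq_lt_of_abs_sub_le {p p₁ p₂ G G₁ G₂ δ w : ℝ} (hG : 0 < G) (hG₁ : 0 < G₁)
    (hG₂ : 0 < G₂) (hδ : 0 ≤ δ) (hw0 : 0 < w) (hw : w ≤ 1 / 1000)
    (h : |p - G| ≤ G * (w / 100)) (h₁ : |p₁ - G₁| ≤ G₁ * (w / 100))
    (h₂ : |p₂ - G₂| ≤ G₂ * (w / 100))
    (hlow : G ^ 2 * ((1 + w) * (1 - w / 10) ^ 2) ≤ G₁ * G₂ * (1 + δ))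
    (hup : G₁ * G₂ * ((1 - w) * (1 + 32 * w)) ≤ G ^ 2) :
    p₁ * p₂ < p ^ 2 ∧ p ^ 2 < p₁ * p₂ * (1 + δ) := by
  obtain ⟨a1, a2⟩ := abs_le.mp h
  obtain ⟨b1, b2⟩ := abs_le.mp h₁
  obtain ⟨c1, c2⟩ := abs_le.mp h₂
  have e0 : 0 < 1 - w / 100 := by linarith
  have f0 : 0 < G * (1 - w / 100) := by positivity
  have f1 : 0 < G₁ * (1 - w / 100) := by positivity
  have f2 : 0 < G₂ * (1 - w / 100) := by positivity
  have w2 := pow_pos hw0 2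
  have w3 := pow_pos hw0 3
  constructor
  · calc p₁ * p₂ ≤ (G₁ * (1 + w / 100)) * (G₂ * (1 + w / 100)) :=
        mul_le_mul (by linarith) (by linarith) (by linarith) (by positivity)
      _ = G₁ * G₂ * (1 + w / 100) ^ 2 := by ring
      _ < G₁ * G₂ * (((1 - w) * (1 + 32 * w)) * (1 - w / 100) ^ 2) := by
        gcongr
        nlinarith
      _ = G₁ * G₂ * ((1 - w) * (1 + 32 * w)) * (1 - w / 100) ^ 2 := by ring
      _ ≤ G ^ 2 * (1 - w / 100) ^ 2 := by gcongr
      _ = (G * (1 - w / 100)) ^ 2 := by ring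
      _ ≤ p ^ 2 := pow_le_pow_left₀ f0.le (by linarith) 2
  · calc p ^ 2 ≤ (G * (1 + w / 100)) ^ 2 := pow_le_pow_left₀ (by linarith) (by linarith) 2
      _ = G ^ 2 * (1 + w / 100) ^ 2 := by ring
      _ < G ^ 2 * (((1 + w) * (1 - w / 10) ^ 2) * (1 - w / 100) ^ 2) := by
        gcongr
        nlinarith
      _ = G ^ 2 * ((1 + w) * (1 - w / 10) ^ 2) * (1 - w / 100) ^ 2 := by ring
      _ ≤ G₁ * G₂ * (1 + δ) * (1 - w / 100) ^ 2 := by gcongr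
      _ = (G₁ * (1 - w / 100)) * (G₂ * (1 - w / 100)) * (1 + δ) := by ring
      _ ≤ p₁ * p₂ * (1 + δ) := mul_le_mul_of_nonneg_right
        (mul_le_mul (by linarith) (by linarith) f2.le (by linarith)) (by linarith)

/-- The partition function is log-concave at `n`, but only barely so. -/
lemma partitionFun_log_concave_bounds {n : ℕ} (hn : 2501 ≤ n) :
    (partitionFun (n + 1) * partitionFun (n - 1) : ℝ) < (partitionFun n : ℝ) ^ 2 ∧
    (partitionFun n : ℝ) ^ 2 < partitionFun (n + 1) * partitionFun (n - 1) *
      (1 + Real.pi / (√24 * (n : ℝ) ^ (3 / 2 : ℝ))) := by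
  have hpi := Real.pi_gt_d2
  have hpi2 := Real.pi_lt_d2
  have hn' : (2501 : ℝ) ≤ n := by exact_mod_cast hn
  obtain ⟨x, hx⟩ : ∃ x : ℝ, x * (n - 1 / 24) = 1 := ⟨_, inv_mul_cancel₀ (by linarith)⟩
  have hx0 : 0 < x := pos_of_mul_pos_left (hx ▸ one_pos) (by linarith)
  have hx1 : x ≤ 1 / 2500 := by nlinarith
  set M := √((n - 1 / 24) * (Real.pi ^ 2 / 6)) with hMdef
  have hA1 : 1.643 < Real.pi ^ 2 / 6 := by nlinarith
  have hA2 : Real.pi ^ 2 / 6 < 1.66 := by nlinarith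
  have hM2 : (n - 1 / 24) * (Real.pi ^ 2 / 6) = M ^ 2 :=
    (Real.sq_sqrt (mul_nonneg (by linarith) (by positivity))).symm
  have hM0 : 0 ≤ M := Real.sqrt_nonneg _
  have hMx : M ^ 2 * x = Real.pi ^ 2 / 6 := by
    rw [← hM2]
    linear_combination (Real.pi ^ 2 / 6) * hx
  have hr2 : (M * √(1 + x)) ^ 2 = M ^ 2 + Real.pi ^ 2 / 6 := by
    rw [mul_pow, Real.sq_sqrt (by linarith : 0 ≤ 1 + x)]; linarith
  have hs2 : (M * √(1 - x)) ^ 2 = M ^ 2 - Real.pi ^ 2 / 6 := by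
    rw [mul_pow, Real.sq_sqrt (by linarith : 0 ≤ 1 - x)]; linarith
  have hs64 : 64 ≤ M * √(1 - x) := by
    refine (pow_le_pow_iff_left₀ (by norm_num) (by positivity) two_ne_zero).mp ?_
    rw [hs2, ← hM2]
    nlinarith
  have hM64 : 64 ≤ M := by
    refine (pow_le_pow_iff_left₀ (by norm_num) (by positivity) two_ne_zero).mp ?_
    nlinarith
  have hr64 : 64 ≤ M * √(1 + x) := by
    refine (pow_le_pow_iff_left₀ (by norm_num) (by positivity) two_ne_zero).mp ?_
    nlinarith
  have key := abs_sub_partitionMain_le_of_sq (x := x) hM64 (by linarith) hM2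
  have keyr := abs_sub_partitionMain_le_of_sq (x := x) (n := n + 1) hr64
    (by rw [hr2]; nlinarith) (by rw [hr2, ← hM2]; push_cast; ring)
  have keys := abs_sub_partitionMain_le_of_sq (x := x) (n := n - 1) hs64
    (by rw [hs2]; nlinarith)
    (by rw [hs2, ← hM2, Nat.cast_sub (by omega)]; push_cast; ring)
  have hlow := sq_partitionMain_mul_le hM64 hx0 hx1 (by linarith)
  have hup := partitionMain_mul_partitionMain_mul_le hM64 hx0 hx1
  have hG := partitionMain_pos (by linarith : 1 ≤ M)
  have hGr := partitionMain_pos (by linarith : 1 ≤ M * √(1 + x))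
  have hGs := partitionMain_pos (by linarith : 1 ≤ M * √(1 - x))
  have hδ := mul_sq_div_two_le hx0 hx hM0 hMx
  have hδ0 : 0 ≤ M * x ^ 2 / 2 * (1 - x / 12) := mul_nonneg (by positivity) (by linarith)
  have hw : x ^ 2 ≤ 1 / 1000 := by nlinarith
  obtain ⟨h1, h2⟩ := mul_lt_sq_and_sq_lt_of_abs_sub_le hG hGr hGs hδ0 (by positivity) hw key keyr
    keys hlow hup
  have hπ : 0 < (2 * Real.pi) ^ 2 := by positivity
  constructor
  · refine lt_of_mul_lt_mul_left ?_ hπ.le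
    linarith
  · refine lt_of_mul_lt_mul_left (lt_of_lt_of_le ?_ (mul_le_mul_of_nonneg_left
      (mul_le_mul_of_nonneg_left (add_le_add_right hδ 1) (by positivity)) hπ.le)) hπ.le
    linarith

lemma four_mul_lt_of_one_lt_mul {U V c : ℝ} (hU : U < 1) (hV : V < 1) (hc : 0 < c)
    (hU' : 1 < U * c) (hV' : 1 < V * c) :
    4 * (1 - U) * (1 - V) < c * (1 - U * V) ^ 2 := by
  set m := (U + V) / 2 with hm
  have hU0 : 0 < U := pos_of_mul_pos_left (by linarith) hc.le
  have hV0 : 0 < V := pos_of_mul_pos_left (by linarith) hc.le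
  have hmc : 1 < m * c := by rw [hm]; linarith
  have hm1 : m < 1 := by rw [hm]; linarith
  have hm0 : 0 < m := by rw [hm]; linarith
  have h1 : 4 * (1 - U) * (1 - V) ≤ 4 * (1 - m) ^ 2 := by
    rw [hm]; nlinarith [sq_nonneg (U - V)]
  have h2 : 1 - m ^ 2 ≤ 1 - U * V := by rw [hm]; nlinarith [sq_nonneg (U - V)]
  have h3 : 4 < c * (1 + m) ^ 2 := by nlinarith [sq_nonneg (1 - m)]
  calc 4 * (1 - U) * (1 - V) ≤ 4 * (1 - m) ^ 2 := h1
    _ < c * (1 + m) ^ 2 * (1 - m) ^ 2 := by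
      have : 0 < (1 - m) ^ 2 := pow_pos (by linarith) 2
      gcongr
    _ = c * (1 - m ^ 2) ^ 2 := by ring
    _ ≤ c * (1 - U * V) ^ 2 := by
      gcongr
      nlinarith

lemma chen_conjecture_of_le {n : ℕ} (hn : 2501 ≤ n) :
    4 * (1 - u n) * (1 - u (n + 1)) <
      (1 + Real.pi / (√24 * (n : ℝ) ^ (3 / 2 : ℝ))) * (1 - u n * u (n + 1)) ^ 2 := by
  have hpos (m : ℕ) : (0 : ℝ) < (partitionFun m : ℝ) ^ 2 := by
    have : 0 < partitionFun m := Fintype.card_pos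
    positivity
  have hn0 : (0 : ℝ) < n := by exact_mod_cast (by omega : 0 < n)
  have hpi := Real.pi_pos
  obtain ⟨h1, h2⟩ := partitionFun_log_concave_bounds hn
  obtain ⟨h3, h4⟩ := partitionFun_log_concave_bounds (hn.trans n.le_succ)
  refine four_mul_lt_of_one_lt_mul ?_ ?_ (by positivity) ?_ ?_
  · exact (div_lt_one (hpos n)).mpr h1
  · exact (div_lt_one (hpos (n + 1))).mpr h3
  · rw [u, div_mul_eq_mul_div, one_lt_div (hpos n)]
    exact h2
  · rw [u, div_mul_eq_mul_div, one_lt_div (hpos (n + 1))]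
    refine h4.trans_le ?_
    gcongr
    exact n.le_succ

/-! ### Verification of the inequality for small indices -/

lemma partitionFun_lt_two_pow {n : ℕ} (hn : n < 2503) : partitionFun n < 2 ^ 256 := by
  have hpi := Real.pi_gt_three
  have hpi2 := Real.pi_lt_d2
  set r := Real.exp (-(1 / 25)) with hr
  have hr1 : r < 1 := by rw [hr, Real.exp_lt_one_iff]; norm_num
  have h1 := le_hasSum (hasSum_inv_eulerProd_real (Real.exp_pos _).le hr1) n
    fun _ _ ↦ by positivity
  have hz : (r : ℂ) = Complex.exp (-((1 / 25 : ℝ) : ℂ)) := by rw [hr]; push_cast; rfl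
  have h2 : ‖(eulerProd (r : ℂ))⁻¹‖ ≤ Real.exp 43 := by
    rw [hz, inv_eulerProd_cexp_neg (by norm_num), norm_mul, norm_mul]
    have e1 : ‖(((1 / 25 : ℝ) : ℂ) / (2 * Real.pi)) ^ (1 / 2 : ℂ)‖ ≤ 1 := by
      rw [show ((1 / 25 : ℝ) : ℂ) / (2 * Real.pi) = ((1 / 25 / (2 * Real.pi) : ℝ) : ℂ) by
        push_cast; rfl, Complex.norm_cpow_eq_rpow_re_of_pos (by positivity)]
      refine Real.rpow_le_one (by positivity) ?_ (by norm_num)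
      rw [div_le_one (by positivity)]
      linarith
    have e2 : ‖Complex.exp (Real.pi ^ 2 / 6 / ((1 / 25 : ℝ) : ℂ) - ((1 / 25 : ℝ) : ℂ) / 24)‖ ≤
        Real.exp 42 := by
      rw [show (Real.pi ^ 2 / 6 / ((1 / 25 : ℝ) : ℂ) - ((1 / 25 : ℝ) : ℂ) / 24 : ℂ) =
        ((Real.pi ^ 2 / 6 / (1 / 25) - 1 / 25 / 24 : ℝ) : ℂ) by push_cast; rfl,
        ← Complex.ofReal_exp, Complex.norm_real, Real.norm_of_nonneg (Real.exp_pos _).le]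
      apply Real.exp_le_exp.mpr
      nlinarith
    have e3 : ‖(eulerProd (Complex.exp (-(4 * Real.pi ^ 2 / ((1 / 25 : ℝ) : ℂ)))))⁻¹‖ ≤ 2 := by
      rw [show (-(4 * Real.pi ^ 2 / ((1 / 25 : ℝ) : ℂ)) : ℂ) =
        ((-(4 * Real.pi ^ 2 / (1 / 25)) : ℝ) : ℂ) by push_cast; rfl, ← Complex.ofReal_exp]
      have e4 : Real.exp (-(4 * Real.pi ^ 2 / (1 / 25))) ≤ 1 / 10 := by
        rw [Real.exp_neg, ← one_div]
        refine one_div_le_one_div_of_le (by norm_num) ?_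
        nlinarith [Real.add_one_le_exp (4 * Real.pi ^ 2 / (1 / 25))]
      have e5 : ‖((Real.exp (-(4 * Real.pi ^ 2 / (1 / 25))) : ℝ) : ℂ)‖ ≤ 1 / 10 := by
        rwa [Complex.norm_real, Real.norm_of_nonneg (Real.exp_pos _).le]
      have e6 := norm_inv_eulerProd_sub_one_le e5
      have e7 := norm_le_norm_sub_add ((eulerProd
        ((Real.exp (-(4 * Real.pi ^ 2 / (1 / 25))) : ℝ) : ℂ))⁻¹) 1
      rw [norm_one] at e7
      linarith
    calc _ ≤ 1 * Real.exp 42 * 2 := by gcongr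
      _ ≤ Real.exp 42 * Real.exp 1 := by nlinarith [Real.add_one_le_exp 1, Real.exp_pos 42]
      _ = Real.exp 43 := by rw [← Real.exp_add]; norm_num
  have h3 : (partitionFun n : ℝ) ≤ Real.exp 144 := by
    have h4 : (partitionFun n : ℝ) * r ^ n ≤ Real.exp 43 :=
      (h1.trans (Complex.re_le_norm _)).trans h2
    rw [hr, ← Real.exp_nat_mul, mul_neg, Real.exp_neg, ← div_eq_mul_inv,
      div_le_iff₀ (Real.exp_pos _), ← Real.exp_add] at h4
    refine h4.trans (Real.exp_le_exp.mpr ?_)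
    have : (n : ℝ) ≤ 2502 := by exact_mod_cast Nat.le_of_lt_succ hn
    linarith
  have h5 : Real.exp 144 < 2 ^ 256 := by
    rw [show (144 : ℝ) = (144 : ℕ) * 1 by norm_num, Real.exp_nat_mul]
    calc Real.exp 1 ^ 144 ≤ 2.7182818286 ^ 144 :=
          pow_le_pow_left₀ (Real.exp_pos 1).le Real.exp_one_lt_d9.le 144
      _ < _ := by norm_num
  exact_mod_cast h3.trans_lt h5

/-- Euler's pentagonal number theorem, truncated and evaluated at an integer. -/
lemma pow_dvd_sum_pentagonal_mul_sum_partitionFun_sub_one (B : ℤ) (K : ℕ) (S : Finset ℤ)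
    (hS : ∀ k, pentagonal k < K → k ∈ S) :
    B ^ K ∣ (∑ k ∈ S, (Int.negOnePow k : ℤ) * B ^ pentagonal k) *
      (∑ m ∈ Finset.range K, (partitionFun m : ℤ) * B ^ m) - 1 := by
  obtain ⟨ε, hε⟩ : ∃ ε : ℤ → ℤ, ∀ k, (Int.negOnePow k : ℤ) = ε k := ⟨_, fun _ ↦ rfl⟩
  simp only [hε]
  set e : Polynomial ℤ := ∑ k ∈ S, Polynomial.C (ε k) * Polynomial.X ^ pentagonal k
    with he
  set q : Polynomial ℤ :=
    ∑ m ∈ Finset.range K, Polynomial.C (partitionFun m : ℤ) * Polynomial.X ^ m with hq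
  have hec (d : ℕ) (hd : d < K) :
      e.coeff d = PowerSeries.coeff d (PowerSeries.pentagonalSeries ℤ) := by
    simp only [he, Polynomial.finsetSum_coeff, Polynomial.coeff_C_mul, Polynomial.coeff_X_pow]
    by_cases h : d ∈ Set.range pentagonal
    · obtain ⟨k, rfl⟩ := h
      rw [PowerSeries.coeff_pentagonalSeries_pentagonal, Finset.sum_eq_single k]
      · rw [if_pos rfl, mul_one, ← hε, Int.cast_id]
      · intro j _ hj
        rw [if_neg fun h ↦ hj (pentagonal_injective h).symm, mul_zero]
      · exact fun h ↦ absurd (hS k hd) h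
    · rw [PowerSeries.coeff_pentagonalSeries_eq_zero _ h]
      refine Finset.sum_eq_zero fun k _ ↦ ?_
      rw [if_neg fun hk ↦ h ⟨k, hk.symm⟩, mul_zero]
  have hqc (d : ℕ) (hd : d < K) : q.coeff d = PowerSeries.coeff d (partitionSeries ℤ) := by
    simp [hq, Polynomial.finsetSum_coeff, Polynomial.coeff_X_pow, partitionSeries, hd]
  have hdvd : Polynomial.X ^ K ∣ e * q - 1 := by
    rw [Polynomial.X_pow_dvd_iff]
    intro d hd
    rw [Polynomial.coeff_sub, sub_eq_zero, Polynomial.coeff_mul, Polynomial.coeff_one]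
    have h := congrArg (PowerSeries.coeff d)
      ((mul_comm _ _).trans (partitionSeries_mul_pentagonalSeries ℤ))
    rw [PowerSeries.coeff_mul, PowerSeries.coeff_one] at h
    rw [← h]
    refine Finset.sum_congr rfl fun ij hij ↦ ?_
    have := Finset.HasAntidiagonal.mem_antidiagonal.mp hij
    rw [hec _ (by omega), hqc _ (by omega)]
  have := map_dvd (Polynomial.evalRingHom B) hdvd
  simpa [he, hq, Polynomial.eval_finsetSum] using this

lemma sum_mul_pow_div_pow_mod {B m : ℕ} {f : ℕ → ℕ} (hf : ∀ i ≤ m, f i < B) :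
    (∑ i ∈ Finset.range (m + 1), f i * B ^ i) / B ^ m % B = f m := by
  have hB : 0 < B := (Nat.zero_le _).trans_lt (hf m le_rfl)
  have hlt (j : ℕ) (hj : j ≤ m) : ∑ i ∈ Finset.range j, f i * B ^ i < B ^ j := by
    induction j with
    | zero => simp
    | succ j ih =>
      rw [Finset.sum_range_succ, pow_succ]
      have h1 := ih (by omega)
      have h2 : (f j + 1) * B ^ j ≤ B * B ^ j := Nat.mul_le_mul_right _ (hf j (by omega))
      linarith
  rw [Finset.sum_range_succ, Nat.add_mul_div_right _ _ (pow_pos hB m),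
    Nat.div_eq_of_lt (hlt m le_rfl), zero_add, Nat.mod_eq_of_lt (hf m le_rfl)]

/-- The sum of `(-1) ^ k * 2 ^ (256 * k (3 k - 1) / 2)` over `|k| ≤ 41`. -/
noncomputable def pentagonalPacked : ℤ :=
  ∑ k ∈ Finset.Icc (-41 : ℤ) 41,
    (if k % 2 = 0 then 1 else -1) * ((2 ^ (256 * pentagonal k) : ℕ) : ℤ)

/-- `n` steps of Newton's iteration for the inverse of `E` modulo `W`. -/
def newtonInverse (W E : ℕ) : ℕ → ℕ
  | 0 => 1
  | n + 1 =>
    Nat.rec 0 (fun d _ ↦ (d + 1) * (W + 2 - E * (d + 1) % W) % W) (newtonInverse W E n)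

/-- The number whose `m`-th digit in base `2 ^ 256` is `p(m)` for `m < 2503`. -/
noncomputable def partitionsPacked : ℕ :=
  newtonInverse (2 ^ (256 * 2503)) (pentagonalPacked % (2 ^ (256 * 2503) : ℕ)).toNat 12

lemma pentagonalPacked_mul_partitionsPacked :
    pentagonalPacked * partitionsPacked % (2 ^ (256 * 2503) : ℕ) = 1 := by
  decide +kernel

lemma pentagonalPacked_eq : pentagonalPacked =
    ∑ k ∈ Finset.Icc (-41 : ℤ) 41, (Int.negOnePow k : ℤ) * (2 ^ 256 : ℤ) ^ pentagonal k := by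
  refine Finset.sum_congr rfl fun k _ ↦ ?_
  rw [← pow_mul]
  push_cast
  congr 1
  rcases Int.even_or_odd k with h | h
  · rw [if_pos (Int.even_iff.mp h), Int.negOnePow_even k h]; rfl
  · rw [if_neg (by rw [Int.odd_iff.mp h]; norm_num), Int.negOnePow_odd k h]; rfl

lemma partitionsPacked_div_pow_mod {m : ℕ} (hm : m < 2503) :
    partitionsPacked / (2 ^ 256) ^ m % 2 ^ 256 = partitionFun m := by
  have h1 := pow_dvd_sum_pentagonal_mul_sum_partitionFun_sub_one (2 ^ 256) (m + 1)
    (Finset.Icc (-41) 41) fun k hk ↦ by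
      have h := two_mul_natCast_pentagonal k
      have hk' : (pentagonal k : ℤ) ≤ 2502 := by omega
      rw [Finset.mem_Icc]
      constructor <;> nlinarith
  rw [← pentagonalPacked_eq] at h1
  have h2 : ((2 ^ 256 : ℤ) ^ (m + 1)) ∣ pentagonalPacked * partitionsPacked - 1 := by
    refine Dvd.dvd.trans ?_ (Int.dvd_self_sub_of_emod_eq pentagonalPacked_mul_partitionsPacked)
    rw [pow_mul, Nat.cast_pow]
    exact_mod_cast pow_dvd_pow (2 ^ 256 : ℕ) hm
  set P := ∑ i ∈ Finset.range (m + 1), partitionFun i * (2 ^ 256) ^ i with hP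
  have h3 : partitionsPacked ≡ P [MOD (2 ^ 256) ^ (m + 1)] := by
    rw [← Int.natCast_modEq_iff, Int.modEq_iff_dvd]
    have e : ((P : ℕ) : ℤ) - partitionsPacked =
        partitionsPacked * (pentagonalPacked * (∑ i ∈ Finset.range (m + 1),
          (partitionFun i : ℤ) * (2 ^ 256) ^ i) - 1) -
        P * (pentagonalPacked * partitionsPacked - 1) := by
      rw [hP]; push_cast; ring
    rw [e]
    push_cast
    exact dvd_sub (h1.mul_left _) (h2.mul_left _)
  rw [← Nat.mod_mul_right_div_self, ← pow_succ, h3, pow_succ, Nat.mod_mul_right_div_self, hP]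
  exact sum_mul_pow_div_pow_mod fun i hi ↦ partitionFun_lt_two_pow (by omega)

/-- The conjectured inequality at `n` with `a, b, c, d` in place of `p(n - 1), …, p(n + 2)`, with
denominators cleared, `π ^ 2` replaced by `9.8696` and the square root removed by squaring. -/
def chenCheck (a b c d n : ℕ) : Bool :=
  let X : ℤ := (b * b : ℕ)
  let Y : ℤ := (c * a : ℕ)
  let X' : ℤ := (c * c : ℕ)
  let Y' : ℤ := (d * b : ℕ)
  let L : ℤ := 4 * (X - Y) * (X' - Y') * (X * X')
  let R : ℤ := (X * X' - Y * Y') * (X * X' - Y * Y')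
  decide (L < R) || (decide (0 < R) &&
    decide ((L - R) * (L - R) * (24000000 * (n * n * n : ℕ)) < 9869600 * (R * R)))

/-- Checks `k` consecutive inequalities starting at `n`, reading `p(n + 2), p(n + 3), …` from the
digits of `D` in base `2 ^ 256`. -/
def chenCheckFrom : ℕ → ℕ → ℕ → ℕ → ℕ → ℕ → Bool
  | 0, _, _, _, _, _ => true
  | k + 1, n, a, b, c, D =>
    Nat.rec false (fun d _ ↦ chenCheck a b c ((d + 1) % 2 ^ 256) n &&
      chenCheckFrom k (n + 1) b c ((d + 1) % 2 ^ 256) ((d + 1) / 2 ^ 256)) D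

lemma chenCheckFrom_partitionsPacked :
    chenCheckFrom 2499 (1 + 1) (partitionsPacked / (2 ^ 256) ^ 1 % 2 ^ 256)
      (partitionsPacked / (2 ^ 256) ^ (1 + 1) % 2 ^ 256)
      (partitionsPacked / (2 ^ 256) ^ (1 + 2) % 2 ^ 256)
      (partitionsPacked / (2 ^ 256) ^ (1 + 3)) = true := by
  decide +kernel

lemma chenCheck_of_chenCheckFrom_succ {k n a b c D : ℕ}
    (h : chenCheckFrom (k + 1) n a b c D = true) :
    chenCheck a b c (D % 2 ^ 256) n = true ∧
      chenCheckFrom k (n + 1) b c (D % 2 ^ 256) (D / 2 ^ 256) = true := by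
  cases D with
  | zero => exact absurd h Bool.false_ne_true
  | succ d => exact (Bool.and_eq_true_iff).mp h

lemma chenCheck_digits_of_chenCheckFrom (P : ℕ) {k n m : ℕ} (hnm : n ≤ m) (hm : m < n + k)
    (h : chenCheckFrom k (n + 1) (P / (2 ^ 256) ^ n % 2 ^ 256)
      (P / (2 ^ 256) ^ (n + 1) % 2 ^ 256) (P / (2 ^ 256) ^ (n + 2) % 2 ^ 256)
      (P / (2 ^ 256) ^ (n + 3)) = true) :
    chenCheck (P / (2 ^ 256) ^ m % 2 ^ 256) (P / (2 ^ 256) ^ (m + 1) % 2 ^ 256)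
      (P / (2 ^ 256) ^ (m + 2) % 2 ^ 256) (P / (2 ^ 256) ^ (m + 3) % 2 ^ 256) (m + 1) = true := by
  induction k generalizing n with
  | zero => omega
  | succ k ih =>
    obtain ⟨h1, h2⟩ := chenCheck_of_chenCheckFrom_succ h
    rcases hnm.eq_or_lt with rfl | hlt
    · exact h1
    · refine ih (n := n + 1) hlt (by omega) ?_
      rwa [Nat.div_div_eq_div_mul, ← pow_succ] at h2

lemma chenCheck_partitionFun {n : ℕ} (hn : 2 ≤ n) (hn' : n < 2501) :
    chenCheck (partitionFun (n - 1)) (partitionFun n) (partitionFun (n + 1))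
      (partitionFun (n + 2)) n = true := by
  obtain ⟨m, rfl⟩ : ∃ m, n = m + 1 := ⟨n - 1, by omega⟩
  have h := chenCheck_digits_of_chenCheckFrom partitionsPacked (k := 2499) (n := 1) (m := m)
    (by omega) (by omega) chenCheckFrom_partitionsPacked
  rwa [partitionsPacked_div_pow_mod (by omega), partitionsPacked_div_pow_mod (by omega),
    partitionsPacked_div_pow_mod (by omega), partitionsPacked_div_pow_mod (by omega)] at h

lemma partitionFun_pos (n : ℕ) : 0 < partitionFun n := Fintype.card_pos

lemma lt_mul_of_sq_mul_lt {L R s : ℝ} (hs : 0 < s)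
    (h : L < R ∨ 0 < R ∧ (L - R) ^ 2 * (24000000 * s ^ 2) < 9869600 * R ^ 2) (hR : 0 ≤ R) :
    L < (1 + Real.pi / (Real.sqrt 24 * s)) * R := by
  have h24 : (0 : ℝ) < √24 := by positivity
  have hδ : 0 < Real.pi / (√24 * s) := by positivity
  rcases h with h | ⟨h0, h⟩
  · nlinarith
  have hsq : (L - R) ^ 2 < (Real.pi / (√24 * s) * R) ^ 2 := by
    rw [mul_pow, div_pow, mul_pow, Real.sq_sqrt (by norm_num), div_mul_eq_mul_div,
      lt_div_iff₀ (by positivity)]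
    have hpi : (9.8696 : ℝ) < Real.pi ^ 2 := by nlinarith [Real.pi_gt_d6]
    nlinarith [mul_pos (sub_pos.mpr hpi) (pow_pos h0 2)]
  have := lt_of_pow_lt_pow_left₀ 2 (by positivity) hsq
  linarith

lemma chen_conjecture_of_lt {n : ℕ} (hn : 2 ≤ n) (hn' : n < 2501) :
    4 * (1 - u n) * (1 - u (n + 1)) <
      (1 + Real.pi / (Real.sqrt 24 * (n : ℝ) ^ (3 / 2 : ℝ))) * (1 - u n * u (n + 1)) ^ 2 := by
  have h := chenCheck_partitionFun hn hn'
  have hn0 : (0 : ℝ) < n := by positivity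
  have hs2 : ((n : ℝ) ^ (3 / 2 : ℝ)) ^ 2 = n ^ 3 := by
    rw [← Real.rpow_natCast, ← Real.rpow_mul hn0.le, ← Real.rpow_natCast]
    norm_num
  have hs : 0 < (n : ℝ) ^ (3 / 2 : ℝ) := by positivity
  have hb := partitionFun_pos n
  have hc := partitionFun_pos (n + 1)
  simp only [u, Nat.add_sub_cancel, show n + 1 + 1 = n + 2 from rfl]
  generalize (n : ℝ) ^ (3 / 2 : ℝ) = s at hs2 hs ⊢
  generalize partitionFun (n - 1) = a at *
  generalize partitionFun n = b at *
  generalize partitionFun (n + 1) = c at *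
  generalize partitionFun (n + 2) = d at *
  have hb' : (0 : ℝ) < b := by exact_mod_cast hb
  have hc' : (0 : ℝ) < c := by exact_mod_cast hc
  simp only [chenCheck, Bool.or_eq_true, Bool.and_eq_true, decide_eq_true_eq] at h
  have key := lt_mul_of_sq_mul_lt hs
    (L := 4 * (b ^ 2 - c * a) * (c ^ 2 - d * b) * (b ^ 2 * c ^ 2))
    (R := (b ^ 2 * c ^ 2 - c * a * (d * b)) ^ 2) (by
      rw [hs2]
      convert h using 1
      · rw [← Int.cast_lt (R := ℝ)]; push_cast; ring_nf
      · rw [← Int.cast_lt (R := ℝ), ← Int.cast_lt (R := ℝ)]; push_cast; ring_nf)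
    (sq_nonneg _)
  have hD : (0 : ℝ) < (b ^ 2 * c ^ 2) ^ 2 := by positivity
  refine lt_of_mul_lt_mul_right ?_ hD.le
  have hX : (b : ℝ) ≠ 0 := hb'.ne'
  have hX' : (c : ℝ) ≠ 0 := hc'.ne'
  rw [mul_assoc (1 + _)]
  refine (Eq.trans_lt ?_ key).trans_eq ?_
  · field_simp
  · rw [← mul_pow]
    congr 2
    field_simp

theorem chen_conjecture (n : ℕ) (hn : 2 ≤ n) :
    4 * (1 - u n) * (1 - u (n + 1)) <
      (1 + Real.pi / (Real.sqrt 24 * (n : ℝ) ^ (3 / 2 : ℝ))) * (1 - u n * u (n + 1)) ^ 2 := by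
  rcases lt_or_ge n 2501 with h | h
  · exact chen_conjecture_of_lt hn h
  · exact chen_conjecture_of_le h
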